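/- Let d ≥ 4 be an integer and let P ⊂ ℝ^d be a canonical Fano polytope. Then vol(P*) = 2(s_d − 1)^2 / d! if and only if P is unimodularly equivalent to R_(d)*, the dual of the simplex R_(d). -/

import Mathlib

open MeasureTheory Set
open scoped ENNReal

/-- The Sylvester sequence, 0-indexed: `sylvester 0 = 2 = s₁`,
`sylvester (n+1) = (sylvester n)^2 - sylvester n + 1`, so that `sₙ = sylvester (n-1)`. -/
def sylvester : ℕ → ℕ
  | 0 => 2
  | n + 1 => (sylvester n) ^ 2 - sylvester n + 1

/-- A point of `ℝ^d` is a lattice point if all its coordinates are integers. -/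
def IsLatticePt {d : ℕ} (x : Fin d → ℝ) : Prop := ∀ i, ∃ z : ℤ, x i = (z : ℝ)

/-- A lattice polytope: the convex hull of finitely many lattice points. -/
def IsLatticePolytope {d : ℕ} (P : Set (Fin d → ℝ)) : Prop :=
  ∃ V : Finset (Fin d → ℝ), (∀ v ∈ V, IsLatticePt v) ∧ P = convexHull ℝ (V : Set (Fin d → ℝ))

/-- A canonical Fano polytope in `ℝ^d`: a lattice polytope (automatically of full
dimension `d`) whose interior contains exactly one lattice point, namely the origin. -/
def IsCanonicalFano {d : ℕ} (P : Set (Fin d → ℝ)) : Prop :=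
  IsLatticePolytope P ∧ {x ∈ interior P | IsLatticePt x} = {0}

/-- The dual (polar) of a set `P ⊆ ℝ^d`: all `y` with `⟨y, x⟩ ≥ -1` for every `x ∈ P`. -/
def polarDual {d : ℕ} (P : Set (Fin d → ℝ)) : Set (Fin d → ℝ) :=
  {y | ∀ x ∈ P, -1 ≤ ∑ i, y i * x i}

/-- The simplex `S_(d) = conv{0, s₁e₁, …, s_{d-1}e_{d-1}, 2(s_d - 1)e_d}`.
Coordinate `j` (0-indexed) of the basis corresponds to `e_{j+1}`, so the vertex on the
`j`-th axis is `s_{j+1}·e_{j+1}` for `j < d-1` and `2(s_d - 1)·e_d` for `j = d-1`. -/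
def Ssimplex (d : ℕ) : Set (Fin d → ℝ) :=
  convexHull ℝ ({0} ∪ {x : Fin d → ℝ | ∃ j : Fin d,
    x = (if (j : ℕ) = d - 1 then 2 * ((sylvester (d - 1) : ℝ) - 1) else (sylvester (j : ℕ) : ℝ))
      • (Pi.single j (1:ℝ) : Fin d → ℝ)})

/-- The simplex `R_(d) = S_(d) - (e₁ + ⋯ + e_d)`. -/
def Rsimplex (d : ℕ) : Set (Fin d → ℝ) := (fun x => x - fun _ => 1) '' Ssimplex d

/-- Unimodular equivalence: `Q = A·P + b` for some `A ∈ GL_d(ℤ)`, `b ∈ ℤ^d`. -/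
def UnimodularEquiv {d : ℕ} (P Q : Set (Fin d → ℝ)) : Prop :=
  ∃ (A : Matrix (Fin d) (Fin d) ℤ) (b : Fin d → ℤ), IsUnit A.det ∧
    Q = (fun x => (A.map (fun z : ℤ => (z : ℝ))).mulVec x + fun i => ((b i : ℤ) : ℝ)) '' P

/-- `sylvPred n = sylvester n - 1`, defined without subtraction. -/
def sylvPred : ℕ → ℕ
  | 0 => 1
  | n + 1 => sylvPred n * (sylvPred n + 1)

lemma sylvester_eq (n : ℕ) : sylvester n = sylvPred n + 1 := by
  induction n with
  | zero => rfl
  | succ n ih =>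
    have h : (sylvPred n + 1) ^ 2 = sylvPred n * (sylvPred n + 1) + (sylvPred n + 1) := by ring
    rw [sylvester, ih, sylvPred, h]
    omega

lemma sylvPred_pos (n : ℕ) : 0 < sylvPred n := by
  induction n with
  | zero => simp [sylvPred]
  | succ n ih => simp only [sylvPred]; positivity

lemma sylvPred_pos_real (n : ℕ) : (0 : ℝ) < sylvPred n := by exact_mod_cast sylvPred_pos n

lemma sylvPred_succ_real (n : ℕ) :
    (sylvPred (n + 1) : ℝ) = sylvPred n * (sylvPred n + 1) := by
  simp [sylvPred]

lemma sylvPred_mono : Monotone sylvPred := by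
  refine monotone_nat_of_le_succ fun n => ?_
  simp only [sylvPred]
  nlinarith [sylvPred_pos n]

lemma prod_sylv_inv (n : ℕ) :
    ∏ i ∈ Finset.range n, (1 / ((sylvPred i : ℝ) + 1)) = 1 / sylvPred n := by
  induction n with
  | zero => simp [sylvPred]
  | succ n ih =>
    have := sylvPred_pos_real n
    rw [Finset.prod_range_succ, ih, sylvPred_succ_real]
    field_simp

lemma sum_sylv_inv {r n : ℕ} (h : r ≤ n) :
    ∑ i ∈ Finset.Ico r n, (1 / ((sylvPred i : ℝ) + 1)) = 1 / sylvPred r - 1 / sylvPred n := by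
  induction n, h using Nat.le_induction with
  | base => simp
  | succ n hn ih =>
    have := sylvPred_pos_real n
    rw [Finset.sum_Ico_succ_top hn, ih, sylvPred_succ_real]
    field_simp
    ring

/-- Summation by parts against a nonincreasing nonnegative sequence. -/
lemma sum_mul_nonneg_of_partial_sums {n : ℕ} {c L : ℕ → ℝ} {r : ℕ}
    (hc0 : ∀ i < n, 0 ≤ c i) (hc : ∀ i, i + 1 < n → c (i + 1) ≤ c i)
    (hL : ∀ m, r < m → m ≤ n → 0 ≤ ∑ i ∈ Finset.Ico r m, L i) :
    0 ≤ ∑ i ∈ Finset.Ico r n, c i * L i := by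
  rcases Nat.lt_or_ge r n with hr | hr
  · have key : ∀ m, r ≤ m → m < n →
        c m * ∑ i ∈ Finset.Ico r (m + 1), L i ≤ ∑ i ∈ Finset.Ico r (m + 1), c i * L i := by
      intro m hm
      induction m, hm using Nat.le_induction with
      | base => intro _; simp
      | succ m hm ih =>
        intro hmn
        have h1 := ih (by omega)
        rw [Finset.sum_Ico_succ_top (by omega), Finset.sum_Ico_succ_top (b := m + 1) (by omega)]
        nlinarith [hc m hmn, hL (m + 1) (by omega) (by omega)]
    have h1 := key (n - 1) (by omega) (by omega)
    rw [Nat.sub_add_cancel (by omega)] at h1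
    exact (mul_nonneg (hc0 _ (by omega)) (hL n hr le_rfl)).trans h1
  · simp [Finset.Ico_eq_empty_of_le hr]

lemma eq_zero_of_weighted_suffix {n : ℕ} {c L : ℕ → ℝ}
    (hc0 : ∀ i < n, 0 ≤ c i) (hc : ∀ i, i + 1 < n → c (i + 1) ≤ c i)
    (h : ∀ r < n, 0 ≤ ∑ i ∈ Finset.Ico r n, c i * L i → ∀ i ∈ Finset.Ico r n, L i = 0)
    (h0 : 0 ≤ ∑ i ∈ Finset.range n, L i) : ∀ i < n, L i = 0 := by
  intro i hi
  set A : ℕ → ℝ := fun r => ∑ i ∈ Finset.Ico r n, L i with hA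
  have hsplit : ∀ r m, r ≤ m → m ≤ n → ∑ i ∈ Finset.Ico r m, L i = A r - A m := by
    intro r m h1 h2
    have := Finset.sum_Ico_consecutive L h1 h2
    simp only [hA]; linarith
  have hA0 : 0 ≤ A 0 := by simpa [hA] using h0
  have hAn : A n = 0 := by simp [hA]
  obtain ⟨r, hr, hmax⟩ := Finset.exists_max_image (Finset.range n) A ⟨i, by simpa using hi⟩
  simp only [Finset.mem_range] at hr hmax
  have hmaxr : ∀ m, m ≤ n → A m ≤ A r := by
    intro m hm
    rcases hm.lt_or_eq with h1 | rfl
    · exact hmax m h1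
    · rw [hAn]; exact hA0.trans (hmax 0 (by omega))
  have hz : ∀ r < n, (∀ m, m ≤ n → A m ≤ A r) → ∀ i ∈ Finset.Ico r n, L i = 0 := by
    intro r hr hm
    refine h r hr (sum_mul_nonneg_of_partial_sums hc0 hc fun m h1 h2 => ?_)
    rw [hsplit r m h1.le h2]
    linarith [hm m h2]
  have hAr : A r = 0 := Finset.sum_eq_zero (hz r hr hmaxr)
  refine hz 0 (by omega) (fun m hm => ?_) i (by simpa using hi)
  linarith [hmaxr m hm]

lemma mul_log_div_le {a y : ℝ} (ha : 0 < a) (hy : 0 < y) : a * Real.log (y / a) ≤ y - a := by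
  have := Real.log_le_sub_one_of_pos (div_pos hy ha)
  calc a * Real.log (y / a) ≤ a * (y / a - 1) := by gcongr
    _ = y - a := by field_simp

lemma log_div_eq_zero_of_le {a y : ℝ} (ha : 0 < a) (hy : 0 < y)
    (h : y - a ≤ a * Real.log (y / a)) : Real.log (y / a) = 0 := by
  by_contra hne
  have h1 : y / a ≠ 1 := fun h => hne (by simp [h])
  have := Real.log_lt_sub_one_of_pos (div_pos hy ha) h1
  have h2 : a * Real.log (y / a) < a * (y / a - 1) := by gcongr
  have h3 : a * (y / a - 1) = y - a := by field_simp
  linarith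

/-- Nonincreasing weights satisfying the product-sum inequalities of barycentric coordinates. -/
structure IsWeightSeq (d : ℕ) (b : ℕ → ℝ) : Prop where
  pos : ∀ i ≤ d, 0 < b i
  anti : ∀ i, i + 1 ≤ d → b (i + 1) ≤ b i
  sum : ∑ i ∈ Finset.Ico 0 (d + 1), b i = 1
  prod_le : ∀ j, 1 ≤ j → j ≤ d →
    ∏ i ∈ Finset.range j, b i ≤ ∑ i ∈ Finset.Ico j (d + 1), b i

namespace IsWeightSeq

variable {d : ℕ} {b : ℕ → ℝ}

lemma anti' (h : IsWeightSeq d b) {i j : ℕ} (hij : i ≤ j) (hj : j ≤ d) : b j ≤ b i := by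
  induction j, hij using Nat.le_induction with
  | base => rfl
  | succ j hij ih => exact (h.anti j hj).trans (ih (by omega))

lemma tail_split (_ : IsWeightSeq d b) {r m : ℕ} (h1 : r ≤ m) (h2 : m ≤ d + 1) :
    ∑ i ∈ Finset.Ico r (d + 1), b i =
      ∑ i ∈ Finset.Ico r m, b i + ∑ i ∈ Finset.Ico m (d + 1), b i :=
  (Finset.sum_Ico_consecutive b h1 h2).symm

lemma tail_pos (h : IsWeightSeq d b) {j : ℕ} (hj : j ≤ d) :
    0 < ∑ i ∈ Finset.Ico j (d + 1), b i :=
  Finset.sum_pos (fun i hi => h.pos i (by simp at hi; omega)) ⟨j, by simp; omega⟩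

lemma tail_ge (h : IsWeightSeq d b) {j : ℕ} (hj : j ≤ d) :
    1 / (sylvPred j : ℝ) ≤ ∑ i ∈ Finset.Ico j (d + 1), b i := by
  induction j using Nat.strong_induction_on with
  | _ j ih =>
  rcases Nat.eq_zero_or_pos j with rfl | hj0
  · rw [h.sum]; simp [sylvPred]
  by_contra! hlt
  set y : ℕ → ℝ := fun i => 1 / ((sylvPred i : ℝ) + 1) with hy
  have hypos : ∀ i, 0 < y i := fun i => by
    have := sylvPred_pos_real i
    simp only [hy]; positivity
  have hlt' : ∀ r < j, ∑ i ∈ Finset.Ico r j, b i * Real.log (y i / b i) < 0 := by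
    intro r hr
    have h1 : ∑ i ∈ Finset.Ico r j, b i * Real.log (y i / b i) ≤
        ∑ i ∈ Finset.Ico r j, (y i - b i) := by
      refine Finset.sum_le_sum fun i hi => mul_log_div_le (h.pos i ?_) (hypos i)
      simp at hi; omega
    have h2 := ih r hr (by omega)
    rw [Finset.sum_sub_distrib, sum_sylv_inv hr.le] at h1
    have h3 := h.tail_split hr.le (by omega : j ≤ d + 1)
    linarith
  have h0 : 0 ≤ ∑ i ∈ Finset.range j, Real.log (y i / b i) := by
    rw [← Real.log_prod (fun i hi => ?_)]
    · refine Real.log_nonneg ?_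
      rw [Finset.prod_div_distrib, prod_sylv_inv, one_le_div]
      · exact (h.prod_le j hj0 hj).trans hlt.le
      · exact Finset.prod_pos fun i hi => h.pos i (by simp at hi; omega)
    · have := h.pos i (by simp at hi; omega)
      have := hypos i
      positivity
  have hz := eq_zero_of_weighted_suffix (n := j) (c := b) (L := fun i => Real.log (y i / b i))
    (fun i hi => (h.pos i (by omega)).le) (fun i hi => h.anti i (by omega))
    (fun r hr hr' => absurd hr' (not_le.mpr (hlt' r hr))) h0
  have := hlt' 0 hj0
  rw [Finset.sum_eq_zero] at this
  · exact lt_irrefl _ this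
  · intro i hi
    rw [hz i (by simpa using hi), mul_zero]

/-- If the weights drop sufficiently before position `n`, the product with the `(d - n)`-th power
of the tail is bounded below by its value on the Sylvester weights. -/
lemma prod_mul_tail_pow (h : IsWeightSeq d b) {n e : ℕ} (he : 1 ≤ e) (hne : n + e = d)
    (hdrop : ∀ k, k + 1 = n → ∑ i ∈ Finset.Ico n (d + 1), b i ≤ e * b k)
    (hle : (∏ i ∈ Finset.range n, b i) * (∑ i ∈ Finset.Ico n (d + 1), b i) ^ e ≤
      1 / (sylvPred n : ℝ) ^ (e + 1)) :
    (∀ i < n, b i = 1 / ((sylvPred i : ℝ) + 1)) ∧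
      ∑ i ∈ Finset.Ico n (d + 1), b i = 1 / sylvPred n := by
  set y : ℕ → ℝ := fun i => 1 / ((sylvPred i : ℝ) + 1) with hy
  set t := ∑ i ∈ Finset.Ico n (d + 1), b i with ht
  have he0 : (0 : ℝ) < e := by exact_mod_cast he
  have htpos : 0 < t := h.tail_pos (by omega)
  have hXpos := sylvPred_pos_real n
  have hypos : ∀ i, 0 < y i := fun i => by
    have := sylvPred_pos_real i
    simp only [hy]; positivity
  set c : ℕ → ℝ := fun i => if i < n then b i else t / e with hcdef
  set L : ℕ → ℝ := fun i => if i < n then Real.log (y i / b i)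
    else e * Real.log (1 / sylvPred n / t) with hLdef
  have hcn : c n = t / e := by simp [hcdef]
  have hLn : L n = e * Real.log (1 / sylvPred n / t) := by simp [hLdef]
  have hcL : c n * L n = t * Real.log (1 / sylvPred n / t) := by
    rw [hcn, hLn]; field_simp
  have hci : ∀ i, i < n → c i = b i := fun i hi => by simp [hcdef, hi]
  have hLi : ∀ i, i < n → L i = Real.log (y i / b i) := fun i hi => by simp [hLdef, hi]
  have hz := eq_zero_of_weighted_suffix (n := n + 1) (c := c) (L := L) ?_ ?_ ?_ ?_
  · constructor
    · intro i hi
      have h1 := hz i (by omega)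
      rw [hLi i hi] at h1
      have h2 := h.pos i (by omega)
      have h3 := Real.eq_one_of_pos_of_log_eq_zero (div_pos (hypos i) h2) h1
      rw [div_eq_one_iff_eq h2.ne'] at h3
      exact h3.symm
    · have h1 := hz n (by omega)
      rw [hLn] at h1
      have h2 := Real.eq_one_of_pos_of_log_eq_zero (by positivity)
        ((mul_eq_zero.mp h1).resolve_left he0.ne')
      rw [div_eq_one_iff_eq htpos.ne'] at h2
      exact h2.symm
  · intro i _
    by_cases hi' : i < n
    · rw [hci i hi']; exact (h.pos i (by omega)).le
    · simp only [hcdef, hi', if_false]; positivity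
  · intro i hi
    rw [hci i (by omega)]
    by_cases hi' : i + 1 < n
    · rw [hci _ hi']; exact h.anti i (by omega)
    · have : i + 1 = n := by omega
      rw [this, hcn, div_le_iff₀ he0, mul_comm]
      exact hdrop i this
  · intro r hr hnn
    have hr' : r ≤ n := by omega
    rw [Finset.sum_Ico_succ_top hr', hcL] at hnn
    have hterm : ∀ i ∈ Finset.Ico r n, c i * L i ≤ y i - b i := by
      intro i hi
      simp only [Finset.mem_Ico] at hi
      rw [hci i hi.2, hLi i hi.2]
      exact mul_log_div_le (h.pos i (by omega)) (hypos i)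
    have hlast := mul_log_div_le htpos (by positivity : (0 : ℝ) < 1 / sylvPred n)
    have htot : ∑ i ∈ Finset.Ico r n, (y i - b i) + (1 / sylvPred n - t) ≤ 0 := by
      rw [Finset.sum_sub_distrib, sum_sylv_inv hr']
      have h1 := h.tail_ge (j := r) (by omega)
      have h2 := h.tail_split hr' (by omega : n ≤ d + 1)
      linarith
    have hS := Finset.sum_le_sum hterm
    intro i hi
    simp only [Finset.mem_Ico] at hi
    by_cases hi' : i < n
    · have h1 : y i - b i ≤ c i * L i := by
        by_contra! hlt
        have := Finset.sum_lt_sum hterm ⟨i, by simp; omega, hlt⟩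
        linarith
      rw [hLi i hi']
      rw [hci i hi', hLi i hi'] at h1
      exact log_div_eq_zero_of_le (h.pos i (by omega)) (hypos i) h1
    · have : i = n := by omega
      rw [this, hLn, log_div_eq_zero_of_le htpos (by positivity) (by linarith), mul_zero]
  · rw [Finset.sum_range_succ, hLn, Finset.sum_congr rfl fun i hi => hLi i (by simpa using hi),
      ← Real.log_prod (fun i hi => ?_), ← Real.log_pow, ← Real.log_mul]
    · refine Real.log_nonneg ?_
      have hbp : 0 < ∏ i ∈ Finset.range n, b i :=
        Finset.prod_pos fun i hi => h.pos i (by simp at hi; omega)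
      rw [Finset.prod_div_distrib, prod_sylv_inv, div_pow, div_mul_div_comm,
        one_le_div (by positivity)]
      refine hle.trans (le_of_eq ?_)
      rw [one_div_pow, pow_succ]
      field_simp
    · refine Finset.prod_ne_zero_iff.mpr fun i hi => ?_
      have := h.pos i (by simp at hi; omega)
      have := hypos i
      positivity
    · positivity
    · have := h.pos i (by simp at hi; omega)
      have := hypos i
      positivity

end IsWeightSeq

lemma sylvPred_lower {m : ℕ} (hm : 3 ≤ m) : 3 * (m + 3) ≤ sylvPred m := by
  induction m, hm using Nat.le_induction with
  | base => decide
  | succ m hm ih => simp only [sylvPred]; nlinarith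

lemma add_two_pow_le (e : ℕ) : (e + 2) ^ e ≤ 3 * (e + 1) ^ e := by
  have h1 : (1 + 1 / ((e : ℝ) + 1)) ^ e ≤ 3 := by
    have h2 : 1 + 1 / ((e : ℝ) + 1) ≤ Real.exp (1 / ((e : ℝ) + 1)) := by
      rw [add_comm]; exact Real.add_one_le_exp _
    calc (1 + 1 / ((e : ℝ) + 1)) ^ e ≤ Real.exp (1 / ((e : ℝ) + 1)) ^ e := by gcongr
      _ = Real.exp (e * (1 / ((e : ℝ) + 1))) := by rw [← Real.exp_nat_mul]
      _ ≤ Real.exp 1 := by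
        gcongr
        rw [mul_one_div, div_le_one (by positivity)]
        linarith
      _ ≤ 3 := Real.exp_one_lt_three.le
  have h3 : ((e : ℝ) + 2) ^ e ≤ 3 * ((e : ℝ) + 1) ^ e := by
    have h4 : (e : ℝ) + 2 = (1 + 1 / ((e : ℝ) + 1)) * ((e : ℝ) + 1) := by field_simp; ring
    rw [h4, mul_pow]
    gcongr
  exact_mod_cast h3

lemma sylv_block_lt {n e : ℕ} (he : 2 ≤ e) (hne : 4 ≤ n + e) :
    (e + 1) ^ e * sylvPred n ^ (e + 1) < 2 * sylvPred (n + e - 1) ^ 2 := by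
  have step : ∀ e, 1 ≤ e → 4 ≤ n + e →
      (e + 1) ^ e * sylvPred n ^ (e + 1) < 2 * sylvPred (n + e - 1) ^ 2 →
      (e + 2) ^ (e + 1) * sylvPred n ^ (e + 2) < 2 * sylvPred (n + (e + 1) - 1) ^ 2 := by
    intro e he1 h4 ih
    have hX : sylvPred (n + (e + 1) - 1) =
        sylvPred (n + e - 1) * (sylvPred (n + e - 1) + 1) := by
      have : n + (e + 1) - 1 = (n + e - 1) + 1 := by omega
      rw [this, sylvPred]
    have h1 := sylvPred_lower (m := n + e - 1) (by omega)
    have h2 : sylvPred n ≤ sylvPred (n + e - 1) := sylvPred_mono (by omega)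
    have h3 : 3 * (e + 2) ≤ sylvPred (n + e - 1) + 1 := by omega
    have hXp := sylvPred_pos (n + e - 1)
    calc (e + 2) ^ (e + 1) * sylvPred n ^ (e + 2)
        = (e + 2) ^ e * (e + 2) * (sylvPred n ^ (e + 1) * sylvPred n) := by ring
      _ ≤ (3 * (e + 1) ^ e) * (e + 2) * (sylvPred n ^ (e + 1) * sylvPred n) := by
        gcongr; exact add_two_pow_le e
      _ = ((e + 1) ^ e * sylvPred n ^ (e + 1)) * ((3 * (e + 2)) * sylvPred n) := by ring
      _ ≤ ((e + 1) ^ e * sylvPred n ^ (e + 1)) *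
          ((sylvPred (n + e - 1) + 1) * (sylvPred (n + e - 1) + 1)) := by
        gcongr; omega
      _ < (2 * sylvPred (n + e - 1) ^ 2) *
          ((sylvPred (n + e - 1) + 1) * (sylvPred (n + e - 1) + 1)) := by
        gcongr
      _ = 2 * sylvPred (n + (e + 1) - 1) ^ 2 := by rw [hX]; ring
  rcases Nat.lt_or_ge n 2 with hn | hn
  · interval_cases n
    · obtain ⟨k, rfl⟩ : ∃ k, e = k + 4 := ⟨e - 4, by omega⟩
      clear he hne
      induction k with
      | zero => decide
      | succ k ih => exact step (k + 4) (by omega) (by omega) ih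
    · obtain ⟨k, rfl⟩ : ∃ k, e = k + 3 := ⟨e - 3, by omega⟩
      clear he hne
      induction k with
      | zero => decide
      | succ k ih => exact step (k + 3) (by omega) (by omega) ih
  · clear hne
    induction e, he using Nat.le_induction with
    | base =>
      have h6 : 6 ≤ sylvPred n := sylvPred_mono hn
      have : n + 2 - 1 = n + 1 := by omega
      rw [this, sylvPred]
      have h9 : 9 * sylvPred n < 2 * (sylvPred n + 1) ^ 2 := by nlinarith
      calc (2 + 1) ^ 2 * sylvPred n ^ (2 + 1) = sylvPred n ^ 2 * (9 * sylvPred n) := by ring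
        _ < sylvPred n ^ 2 * (2 * (sylvPred n + 1) ^ 2) := by gcongr
        _ = 2 * (sylvPred n * (sylvPred n + 1)) ^ 2 := by ring
    | succ e he ih => exact step e (by omega) (by omega) ih

/-- Bound for `1 / ∏ bᵢ` over all but the smallest barycentric coordinate. -/
def simplexBound (d : ℕ) : ℕ := if d = 2 then 9 else 2 * sylvPred (d - 1) ^ 2

lemma sylv_block_le {n e : ℕ} (he : 1 ≤ e) :
    (e + 1) ^ e * sylvPred n ^ (e + 1) ≤ simplexBound (n + e) := by
  rcases he.eq_or_lt with rfl | he
  · rw [simplexBound]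
    split_ifs with h
    · obtain rfl : n = 1 := by omega
      decide
    · simp
  · rcases Nat.lt_or_ge (n + e) 4 with h | h
    · have : n ≤ 1 := by omega
      have : e ≤ 3 := by omega
      interval_cases n <;> interval_cases e <;> decide
    · rw [simplexBound, if_neg (by omega)]
      exact (sylv_block_lt he h).le

lemma simplexBound_pos (d : ℕ) : 0 < simplexBound d := by
  have := sylvPred_pos (d - 1)
  rw [simplexBound]; split_ifs <;> positivity

lemma block_step {e : ℕ} {t b : ℝ} (ht : 0 < t) (h1 : t ≤ (e + 2) * b) (h2 : (e + 1) * b ≤ t) :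
    (t / (e + 2)) ^ (e + 1) ≤ b * ((t - b) / (e + 1)) ^ e := by
  set a := t / ((e : ℝ) + 2) with ha
  have ha0 : 0 < a := by positivity
  have hta : t = a * (e + 2) := by rw [ha]; field_simp
  set u := b / a - 1 with hu
  have hb : b = a * (1 + u) := by rw [hu]; field_simp; ring
  have hu0 : 0 ≤ u := by
    rw [hta, hb] at h1
    have : a * (e + 2) * 1 ≤ a * (e + 2) * (1 + u) := by linarith
    have := le_of_mul_le_mul_left this (by positivity)
    linarith
  have hu1 : (e + 1) * u ≤ 1 := by
    rw [hta, hb] at h2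
    have : a * ((e + 1) * (1 + u)) ≤ a * (e + 2) := by linarith
    have := le_of_mul_le_mul_left this (by positivity)
    linarith
  have h3 : (t - b) / (e + 1) = a * (1 + -(u / (e + 1))) := by
    rw [hta, hb]; field_simp; ring
  have hu2 : u / (e + 1) ≤ 1 := by
    rw [div_le_one (by positivity)]; nlinarith [(Nat.cast_nonneg e : (0 : ℝ) ≤ e)]
  have h4 := one_add_mul_le_pow (a := -(u / ((e : ℝ) + 1))) (by linarith) e
  have h5 : 1 ≤ (1 + u) * (1 + -(u / ((e : ℝ) + 1))) ^ e := by
    calc (1 : ℝ) ≤ (1 + u) * (1 + e * -(u / ((e : ℝ) + 1))) := by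
          have : (1 + u) * (1 + e * -(u / ((e : ℝ) + 1))) - 1 =
            u * (1 - e * u) / (e + 1) := by field_simp; ring
          have h6 : 0 ≤ u * (1 - e * u) / (e + 1) := by
            have : 0 ≤ 1 - e * u := by linarith
            positivity
          linarith
      _ ≤ _ := by gcongr
  calc a ^ (e + 1) = a ^ (e + 1) * 1 := by ring
    _ ≤ a ^ (e + 1) * ((1 + u) * (1 + -(u / ((e : ℝ) + 1))) ^ e) := by gcongr
    _ = b * ((t - b) / (e + 1)) ^ e := by rw [h3, mul_pow, hb]; ring

namespace IsWeightSeq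

variable {d : ℕ} {b : ℕ → ℝ}

lemma tail_le (h : IsWeightSeq d b) {l : ℕ} (hl : l ≤ d) :
    ∑ i ∈ Finset.Ico l (d + 1), b i ≤ ((d - l : ℕ) + 1) * b l := by
  have := Finset.sum_le_card_nsmul (Finset.Ico l (d + 1)) b (b l) fun i hi => by
    simp only [Finset.mem_Ico] at hi
    exact h.anti' hi.1 (by omega)
  rw [Nat.card_Ico, nsmul_eq_mul, Nat.sub_add_comm hl] at this
  exact_mod_cast this

lemma tail_succ (_ : IsWeightSeq d b) {l : ℕ} (hl : l ≤ d) :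
    ∑ i ∈ Finset.Ico (l + 1) (d + 1), b i = ∑ i ∈ Finset.Ico l (d + 1), b i - b l := by
  rw [Finset.sum_eq_sum_Ico_succ_bot (by omega : l < d + 1)]; ring

/-- A block of weights without a large drop has product at least that of a constant block. -/
lemma block_prod (h : IsWeightSeq d b) (e : ℕ) : ∀ l, 1 ≤ e → l + e = d →
    (∀ m, l ≤ m → m + 2 ≤ d → ((d - m : ℕ) : ℝ) * b m ≤ ∑ i ∈ Finset.Ico m (d + 1), b i) →
    ((∑ i ∈ Finset.Ico l (d + 1), b i) / (e + 1)) ^ e ≤ ∏ i ∈ Finset.Ico l d, b i := by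
  induction e with
  | zero => intro l h0; omega
  | succ e ih =>
    intro l _ hd hm
    rcases Nat.eq_zero_or_pos e with rfl | he
    · obtain rfl : d = l + 1 := by omega
      have := h.tail_le (l := l) (by omega)
      simp only [Nat.add_sub_cancel_left] at this
      simp only [Nat.Ico_succ_singleton, Finset.prod_singleton, zero_add, pow_one]
      rw [div_le_iff₀ (by positivity)]
      push_cast at this ⊢
      linarith
    · have ih' := ih (l + 1) he (by omega) fun m h1 h2 => hm m (by omega) h2
      rw [h.tail_succ (by omega)] at ih'
      have h1 := hm l le_rfl (by omega)
      have h2 := h.tail_le (l := l) (by omega)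
      have hdl : d - l = e + 1 := by omega
      rw [hdl] at h1 h2
      push_cast at h1 h2
      have h3 := block_step (h.tail_pos (j := l) (by omega)) (by linarith) h1
      rw [Finset.prod_eq_prod_Ico_succ_bot (by omega : l < d)]
      push_cast
      have h4 : (e : ℝ) + 1 + 1 = e + 2 := by ring
      rw [h4]
      refine h3.trans ?_
      have := h.pos l (by omega)
      gcongr

/-- There is a position with a large drop after which the weights form a flat block. -/
lemma exists_drop (h : IsWeightSeq d b) (hd : 1 ≤ d) : ∃ n e, 1 ≤ e ∧ n + e = d ∧
    (∀ k, k + 1 = n → ∑ i ∈ Finset.Ico n (d + 1), b i ≤ e * b k) ∧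
    (∀ m, n ≤ m → m + 2 ≤ d →
      ((d - m : ℕ) : ℝ) * b m ≤ ∑ i ∈ Finset.Ico m (d + 1), b i) := by
  classical
  set p : ℕ → Prop := fun n =>
    ∀ k, k + 1 = n → ∑ i ∈ Finset.Ico n (d + 1), b i ≤ ((d - n : ℕ) : ℝ) * b k with hp
  have hp0 : p 0 := fun k hk => by omega
  set n := Nat.findGreatest p (d - 1) with hn
  have hnd : n ≤ d - 1 := Nat.findGreatest_le _
  refine ⟨n, d - n, by omega, by omega, Nat.findGreatest_spec (Nat.zero_le _) hp0, ?_⟩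
  intro m hm hmd
  have hnot := Nat.findGreatest_is_greatest (P := p) (n := d - 1) (k := m + 1)
    (by omega) (by omega)
  simp only [hp, not_forall, not_le] at hnot
  obtain ⟨k, hk, hlt⟩ := hnot
  obtain rfl : k = m := by omega
  rw [h.tail_succ (by omega)] at hlt
  have : d - k = (d - (k + 1)) + 1 := by omega
  rw [this]; push_cast; linarith

lemma prod_lower (h : IsWeightSeq d b) {n e : ℕ} (he : 1 ≤ e) (hne : n + e = d)
    (hdrop : ∀ k, k + 1 = n → ∑ i ∈ Finset.Ico n (d + 1), b i ≤ e * b k)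
    (hflat : ∀ m, n ≤ m → m + 2 ≤ d →
      ((d - m : ℕ) : ℝ) * b m ≤ ∑ i ∈ Finset.Ico m (d + 1), b i) :
    1 / (((e + 1) ^ e * sylvPred n ^ (e + 1) : ℕ) : ℝ) ≤ ∏ i ∈ Finset.range d, b i := by
  have hXpos := sylvPred_pos_real n
  set t := ∑ i ∈ Finset.Ico n (d + 1), b i with ht
  have hbp : 0 < ∏ i ∈ Finset.range n, b i :=
    Finset.prod_pos fun i hi => h.pos i (by simp at hi; omega)
  have h1 : 1 / (sylvPred n : ℝ) ^ (e + 1) ≤ (∏ i ∈ Finset.range n, b i) * t ^ e := by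
    by_contra! hlt
    obtain ⟨h2, h3⟩ := h.prod_mul_tail_pow he hne hdrop hlt.le
    rw [ht, h3, Finset.prod_congr rfl fun i hi => h2 i (by simpa using hi), prod_sylv_inv] at hlt
    refine lt_irrefl _ (hlt.trans_eq' ?_)
    rw [one_div_pow, pow_succ]
    field_simp
  have h2 := h.block_prod e n he hne hflat
  rw [← ht, div_pow] at h2
  have h3 : ∏ i ∈ Finset.range d, b i =
      (∏ i ∈ Finset.range n, b i) * ∏ i ∈ Finset.Ico n d, b i := by
    rw [Finset.prod_range_mul_prod_Ico _ (by omega)]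
  rw [h3]
  calc 1 / (((e + 1) ^ e * sylvPred n ^ (e + 1) : ℕ) : ℝ)
      = 1 / (sylvPred n : ℝ) ^ (e + 1) / (e + 1) ^ e := by push_cast; field_simp
    _ ≤ (∏ i ∈ Finset.range n, b i) * t ^ e / (e + 1) ^ e := by gcongr
    _ = (∏ i ∈ Finset.range n, b i) * (t ^ e / (e + 1) ^ e) := by ring
    _ ≤ _ := by gcongr

theorem prod_ge (h : IsWeightSeq d b) (hd : 1 ≤ d) :
    1 / (simplexBound d : ℝ) ≤ ∏ i ∈ Finset.range d, b i := by
  obtain ⟨n, e, he, hne, h1, h2⟩ := h.exists_drop hd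
  refine le_trans ?_ (h.prod_lower he hne h1 h2)
  have := sylvPred_pos n
  have h3 := sylv_block_le (n := n) he
  rw [hne] at h3
  gcongr

theorem eq_of_prod_le (h : IsWeightSeq d b) (hd : 4 ≤ d)
    (hle : ∏ i ∈ Finset.range d, b i ≤ 1 / (simplexBound d : ℝ)) :
    (∀ i < d - 1, b i = 1 / ((sylvPred i : ℝ) + 1)) ∧
      b (d - 1) = 1 / (2 * sylvPred (d - 1)) ∧ b d = 1 / (2 * sylvPred (d - 1)) := by
  obtain ⟨n, e, he, hne, h1, h2⟩ := h.exists_drop (by omega)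
  have h3 := h.prod_lower he hne h1 h2
  rcases he.eq_or_lt with rfl | he2
  · obtain rfl : d = n + 1 := by omega
    have hXpos := sylvPred_pos_real n
    rw [simplexBound, if_neg (by omega)] at hle
    simp only [Nat.add_sub_cancel] at hle ⊢
    set t := ∑ i ∈ Finset.Ico n (n + 1 + 1), b i with ht
    have htl := h.tail_le (l := n) (by omega)
    rw [← ht] at htl
    simp only [Nat.add_sub_cancel_left] at htl
    rw [Finset.prod_range_succ] at hle
    have hbp : 0 < ∏ i ∈ Finset.range n, b i :=
      Finset.prod_pos fun i hi => h.pos i (by simp at hi; omega)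
    push_cast at hle htl
    have h4 := h.prod_mul_tail_pow he hne h1 (by
      rw [← ht, pow_one]
      have h5 : (∏ i ∈ Finset.range n, b i) * t ≤ (∏ i ∈ Finset.range n, b i) * (2 * b n) := by
        gcongr; linarith
      have h6 : 1 / (2 * (sylvPred n : ℝ) ^ 2) * 2 = 1 / (sylvPred n : ℝ) ^ (1 + 1) := by
        field_simp
      linarith)
    obtain ⟨h5, h6⟩ := h4
    rw [Finset.prod_congr rfl fun i hi => h5 i (by simpa using hi), prod_sylv_inv] at hle
    have h7 : 1 / (2 * (sylvPred n : ℝ)) ≤ b n := by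
      rw [← ht] at h6
      rw [h6] at htl
      have : 1 / (2 * (sylvPred n : ℝ)) = 1 / sylvPred n / 2 := by field_simp
      linarith
    have h8 : b n ≤ 1 / (2 * (sylvPred n : ℝ)) := by
      have : 1 / (sylvPred n : ℝ) * (1 / (2 * sylvPred n)) = 1 / (2 * (sylvPred n : ℝ) ^ 2) := by
        field_simp
      rw [← this] at hle
      exact le_of_mul_le_mul_left hle (by positivity)
    have h9 : b n = 1 / (2 * (sylvPred n : ℝ)) := le_antisymm h8 h7
    refine ⟨h5, h9, ?_⟩
    have h10 : t = b n + b (n + 1) := by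
      rw [ht, Finset.sum_eq_sum_Ico_succ_bot (by omega), Nat.Ico_succ_singleton,
        Finset.sum_singleton]
    have h11 : 1 / (sylvPred n : ℝ) = 1 / (2 * sylvPred n) + 1 / (2 * sylvPred n) := by
      field_simp; norm_num
    rw [← ht] at h6
    linarith
  · exfalso
    have h4 := sylv_block_lt (n := n) he2 (by omega)
    rw [simplexBound, if_neg (by omega)] at hle
    rw [hne] at h4
    have := sylvPred_pos n
    have h5 : (1 : ℝ) / ((2 * sylvPred (d - 1) ^ 2 : ℕ) : ℝ) <
        1 / (((e + 1) ^ e * sylvPred n ^ (e + 1) : ℕ) : ℝ) := by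
      apply one_div_lt_one_div_of_lt
      · positivity
      · exact_mod_cast h4
    exact absurd (h3.trans hle) (not_le.mpr h5)

lemma second_smallest_ge (h : IsWeightSeq d b) (hd : 1 ≤ d) :
    1 / (2 * sylvPred (d - 1) : ℝ) ≤ b (d - 1) := by
  obtain ⟨n, rfl⟩ : ∃ n, d = n + 1 := ⟨d - 1, by omega⟩
  simp only [Nat.add_sub_cancel]
  have h1 := h.tail_ge (j := n) (by omega)
  have h2 := h.tail_le (l := n) (by omega)
  have := sylvPred_pos_real n
  have h3 : 1 / (2 * (sylvPred n : ℝ)) = 1 / sylvPred n / 2 := by field_simp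
  simp only [Nat.add_sub_cancel_left, Nat.cast_one] at h2
  linarith

end IsWeightSeq

lemma volume_corner_simplex_fin (n : ℕ) : ∀ c : ℝ, 0 ≤ c →
    volume {x : Fin n → ℝ | (∀ i, 0 ≤ x i) ∧ ∑ i, x i ≤ c} =
      ENNReal.ofReal (c ^ n / n.factorial) := by
  induction n with
  | zero =>
    intro c hc
    have : {x : Fin 0 → ℝ | (∀ i, 0 ≤ x i) ∧ ∑ i, x i ≤ c} = Set.univ := by
      ext x; simp [hc]
    rw [this, volume_pi, Measure.pi_univ]; simp
  | succ n ih =>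
    intro c hc
    set S : Set (ℝ × (Fin n → ℝ)) :=
      {p | 0 ≤ p.1 ∧ (∀ i, 0 ≤ p.2 i) ∧ p.1 + ∑ i, p.2 i ≤ c} with hS
    have hSc : IsClosed S := by
      have h1 : IsClosed {p : ℝ × (Fin n → ℝ) | 0 ≤ p.1} :=
        isClosed_le (by fun_prop) (by fun_prop)
      have h2 : IsClosed {p : ℝ × (Fin n → ℝ) | p.1 + ∑ i, p.2 i ≤ c} :=
        isClosed_le (by fun_prop) (by fun_prop)
      have h3 : IsClosed (⋂ i, {p : ℝ × (Fin n → ℝ) | 0 ≤ p.2 i}) :=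
        isClosed_iInter fun i => isClosed_le (by fun_prop) (by fun_prop)
      convert h1.inter (h3.inter h2) using 1
      ext p
      simp [hS]
    have hpre : {x : Fin (n + 1) → ℝ | (∀ i, 0 ≤ x i) ∧ ∑ i, x i ≤ c} =
        MeasurableEquiv.piFinSuccAbove (fun _ : Fin (n + 1) => ℝ) 0 ⁻¹' S := by
      ext x
      simp [hS, Fin.sum_univ_succ, Fin.forall_fin_succ, Fin.tail_def, and_assoc]
    rw [hpre, (volume_preserving_piFinSuccAbove (fun _ : Fin (n + 1) => ℝ) 0).measure_preimage
      hSc.measurableSet.nullMeasurableSet, Measure.volume_eq_prod,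
      Measure.prod_apply hSc.measurableSet]
    have hslice : ∀ x : ℝ, volume (Prod.mk x ⁻¹' S) =
        (Set.Icc 0 c).indicator (fun x => ENNReal.ofReal ((c - x) ^ n / n.factorial)) x := by
      intro x
      by_cases hx : x ∈ Set.Icc 0 c
      · rw [Set.indicator_of_mem hx, ← ih (c - x) (by linarith [hx.2])]
        congr 1
        ext y
        simp [hS, hx.1, le_sub_iff_add_le']
      · rw [Set.indicator_of_notMem hx]
        convert measure_empty (μ := (volume : Measure (Fin n → ℝ)))
        ext y
        simp only [hS, mem_preimage, mem_ofPred_eq, mem_empty_iff_false, iff_false]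
        rintro ⟨h1, h2, h3⟩
        exact hx ⟨h1, by linarith [Finset.sum_nonneg fun i (_ : i ∈ Finset.univ) => h2 i]⟩
    simp_rw [hslice]
    rw [lintegral_indicator measurableSet_Icc, ← ofReal_integral_eq_lintegral_ofReal]
    · congr 1
      rw [integral_Icc_eq_integral_Ioc, ← intervalIntegral.integral_of_le hc,
        intervalIntegral.integral_div, intervalIntegral.integral_comp_sub_left (fun x => x ^ n) c]
      simp only [sub_self, sub_zero, integral_pow]
      rw [Nat.factorial_succ]
      push_cast
      simp only [ne_eq, Nat.add_eq_zero_iff, one_ne_zero, and_false, not_false_eq_true, zero_pow,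
        sub_zero]
      rw [div_div]
    · exact (Continuous.integrableOn_Icc (by fun_prop))
    · refine (ae_restrict_iff' measurableSet_Icc).mpr (Filter.Eventually.of_forall fun x hx => ?_)
      have : 0 ≤ c - x := by linarith [hx.2]
      simp only [Pi.zero_apply]
      positivity

lemma volume_corner_simplex {κ : Type} [Fintype κ] :
    volume {x : κ → ℝ | (∀ i, 0 ≤ x i) ∧ ∑ i, x i ≤ 1} =
      ENNReal.ofReal (1 / (Fintype.card κ).factorial) := by
  have h := volume_corner_simplex_fin (Fintype.card κ) 1 zero_le_one
  rw [one_pow] at h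
  rw [← h, ← (volume_measurePreserving_piCongrLeft (fun _ : κ => ℝ)
    (Fintype.equivFin κ).symm).measure_preimage_equiv]
  congr 1
  ext x
  simp only [mem_ofPred_eq, mem_preimage]
  have hx : ∀ i, (MeasurableEquiv.piCongrLeft (fun _ : κ => ℝ) (Fintype.equivFin κ).symm) x i =
      x (Fintype.equivFin κ i) := by
    intro i
    obtain ⟨j, rfl⟩ := (Fintype.equivFin κ).symm.surjective i
    rw [Equiv.apply_symm_apply]
    exact Equiv.piCongrLeft_apply_apply (fun _ : κ => ℝ) _ x j
  simp only [hx]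
  rw [Equiv.sum_comp (Fintype.equivFin κ) x, (Fintype.equivFin κ).forall_congr_left]
  simp

/-- The volume of the simplex cut out by `uᵢ ≥ -1` and `∑ γᵢ (uᵢ + 1) ≤ 1`. -/
lemma volume_weighted_simplex {κ : Type} [Fintype κ] {γ : κ → ℝ} (hγ : ∀ i, 0 < γ i) :
    volume {u : κ → ℝ | (∀ i, -1 ≤ u i) ∧ ∑ i, γ i * (u i + 1) ≤ 1} =
      ENNReal.ofReal (1 / ((Fintype.card κ).factorial * ∏ i, γ i)) := by
  classical
  have hp : 0 < ∏ i, γ i := Finset.prod_pos fun i _ => hγ i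
  set S := {x : κ → ℝ | (∀ i, 0 ≤ x i) ∧ ∑ i, x i ≤ 1} with hS
  have h1 : {u : κ → ℝ | (∀ i, -1 ≤ u i) ∧ ∑ i, γ i * (u i + 1) ≤ 1} =
      (fun u => u + 1) ⁻¹' (Matrix.toLin' (Matrix.diagonal γ) ⁻¹' S) := by
    ext u
    simp only [hS, mem_ofPred_eq, mem_preimage, Matrix.toLin'_apply, Matrix.mulVec_diagonal,
      Pi.add_apply, Pi.one_apply]
    refine and_congr (forall_congr' fun i => ?_) Iff.rfl
    rw [mul_nonneg_iff_of_pos_left (hγ i)]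
    constructor <;> intro h <;> linarith
  rw [h1, measure_preimage_add_right, Measure.addHaar_preimage_linearMap, volume_corner_simplex,
    ← ENNReal.ofReal_mul (by positivity)]
  · congr 1
    rw [LinearMap.det_toLin', Matrix.det_diagonal, abs_of_pos (by positivity)]
    field_simp
  · rw [LinearMap.det_toLin', Matrix.det_diagonal]; exact hp.ne'

/-- Covering by a product of a set and a weighted simplex, in coordinates indexed by a sum type. -/
lemma volume_sum_le {ι κ : Type} [Fintype ι] [Fintype κ] {D : Set (ι ⊕ κ → ℝ)}
    {D₁ : Set (ι → ℝ)} {D₂ : Set (κ → ℝ)}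
    (h : ∀ t ∈ D, (fun i => t (Sum.inl i)) ∈ D₁ ∧ (fun j => t (Sum.inr j)) ∈ D₂) :
    volume D ≤ volume D₁ * volume D₂ := by
  rw [← Measure.prod_prod, ← Measure.volume_eq_prod,
    ← (volume_measurePreserving_sumPiEquivProdPi (fun _ : ι ⊕ κ => ℝ)).measure_preimage_equiv]
  exact measure_mono fun t ht => h t ht

/-- A positively weighted affine dependency of a minimally dependent finite set around the
origin. -/
structure IsCirc {E : Type*} [AddCommGroup E] [Module ℝ E] (C : Finset E) (γ : E → ℝ) : Prop where
  pos : ∀ v ∈ C, 0 < γ v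
  sum : ∑ v ∈ C, γ v = 1
  zero : ∑ v ∈ C, γ v • v = 0
  unique : ∀ δ : E → ℝ, ∑ v ∈ C, δ v • v = 0 → ∃ l : ℝ, ∀ v ∈ C, δ v = l * γ v

/-- An application of Minkowski's theorem on lattice points in symmetric convex bodies. -/
lemma exists_int_approx {ι : Type*} [Fintype ι] {β : ι → ℝ} (hβ : ∀ i, 0 < β i)
    (h1 : ∑ i, β i < 1) (h2 : 1 - ∑ i, β i < ∏ i, β i) :
    ∃ p : ι → ℤ, p ≠ 0 ∧ ∀ i, |(p i : ℝ) - β i * ∑ j, (p j : ℝ)| < β i := by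
  classical
  set M : Matrix ι ι ℝ := 1 - (Matrix.replicateCol Unit β : Matrix ι Unit ℝ) *
    (Matrix.replicateRow Unit 1 : Matrix Unit ι ℝ) with hM
  have hdet : M.det = 1 - ∑ i, β i := by
    rw [hM, Matrix.det_one_sub_mul_comm, Matrix.det_unique]
    simp [Matrix.mul_apply]
  have hMv : ∀ x i, M.mulVec x i = x i - β i * ∑ j, x j := by
    intro x i
    rw [hM, Matrix.sub_mulVec, Matrix.one_mulVec]
    simp [Matrix.mulVec, dotProduct, Matrix.mul_apply, Finset.mul_sum]
  set B : Set (ι → ℝ) := Set.univ.pi fun i => Set.Ioo (-β i) (β i) with hB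
  set S : Set (ι → ℝ) := Matrix.toLin' M ⁻¹' B with hS
  have hmem : ∀ x, x ∈ S ↔ ∀ i, |x i - β i * ∑ j, x j| < β i := by
    intro x
    simp [hS, hB, hMv, abs_lt, Set.mem_pi]
  have hvol : volume S = ENNReal.ofReal ((∏ i, β i) / (1 - ∑ i, β i) * 2 ^ Fintype.card ι) := by
    rw [hS, Measure.addHaar_preimage_linearMap, hB, volume_pi_pi]
    · simp only [Real.volume_Ioo]
      rw [← ENNReal.ofReal_prod_of_nonneg (fun i _ => by linarith [hβ i]),
        ← ENNReal.ofReal_mul (abs_nonneg _), LinearMap.det_toLin', hdet,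
        abs_of_pos (inv_pos.mpr (by linarith))]
      congr 1
      have : ∀ i, β i - -β i = β i * 2 := fun i => by ring
      simp_rw [this, Finset.prod_mul_distrib]
      simp only [Finset.prod_const, Finset.card_univ]
      ring
    · rw [LinearMap.det_toLin', hdet]; linarith
  have : Countable (Submodule.span ℤ (Set.range (Pi.basisFun ℝ ι))).toAddSubgroup :=
    inferInstanceAs (Countable (Submodule.span ℤ (Set.range (Pi.basisFun ℝ ι))))
  have hsymm : ∀ x ∈ S, -x ∈ S := by
    intro x hx
    rw [hmem] at hx ⊢
    intro i
    rw [← abs_neg]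
    convert hx i using 2
    simp
    ring
  have hconv : Convex ℝ S := (convex_pi fun i _ => convex_Ioo _ _).linear_preimage _
  have hlt : volume (ZSpan.fundamentalDomain (Pi.basisFun ℝ ι)) * 2 ^ Module.finrank ℝ (ι → ℝ) <
      volume S := by
    rw [ZSpan.volume_fundamentalDomain, hvol]
    have h3 : (Matrix.of (Pi.basisFun ℝ ι) : Matrix ι ι ℝ) = 1 := by
      ext i j
      simp [Matrix.one_apply, Pi.single_apply, eq_comm]
    rw [h3, Matrix.det_one, Module.finrank_fintype_fun_eq_card]
    simp only [abs_one, ENNReal.ofReal_one, one_mul]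
    have h4 : (2 : ℝ≥0∞) ^ Fintype.card ι = ENNReal.ofReal (2 ^ Fintype.card ι) := by
      rw [ENNReal.ofReal_pow (by norm_num)]; norm_num
    rw [h4]
    have h5 : 1 < (∏ i, β i) / (1 - ∑ i, β i) := by
      rw [one_lt_div (by linarith)]; exact h2
    have h6 : (0 : ℝ) < 2 ^ Fintype.card ι := by positivity
    refine (ENNReal.ofReal_lt_ofReal_iff (by positivity)).mpr ?_
    nlinarith
  obtain ⟨x, hx0, hxS⟩ := exists_ne_zero_mem_lattice_of_measure_mul_two_pow_lt_measure
    (ZSpan.isAddFundamentalDomain' (Pi.basisFun ℝ ι) volume) hsymm hconv hlt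
  have hx := x.2
  rw [Submodule.mem_toAddSubgroup, (Pi.basisFun ℝ ι).mem_span_iff_repr_mem ℤ] at hx
  choose p hp using hx
  have hp' : ∀ i, (p i : ℝ) = (x : ι → ℝ) i := fun i => by simpa using hp i
  refine ⟨p, ?_, ?_⟩
  · rintro rfl
    apply hx0
    ext i
    simpa using (hp' i).symm
  · intro i
    simp only [hp']
    exact (hmem _).mp hxS i

lemma IsCirc.mem_interior {E : Type*} [AddCommGroup E] [Module ℝ E] [TopologicalSpace E]
    [IsTopologicalAddGroup E] [ContinuousConstSMul ℝ E] {C : Finset E}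
    {γ : E → ℝ} (hC : IsCirc C γ) {P : Set E} (hP : Convex ℝ P) (h0 : 0 ∈ interior P)
    (hCP : ∀ v ∈ C, v ∈ P) {a : E → ℝ} (ha : ∀ v ∈ C, 0 < a v) (ha1 : ∑ v ∈ C, a v = 1) :
    ∑ v ∈ C, a v • v ∈ interior P := by
  have hne : C.Nonempty := by
    rw [Finset.nonempty_iff_ne_empty]; rintro rfl; simpa using hC.sum
  obtain ⟨w, hw, hmin⟩ := Finset.exists_min_image C (fun v => a v / γ v) hne
  set r := min (a w / γ w) (1 / 2) with hr
  have hr0 : 0 < r := lt_min (div_pos (ha w hw) (hC.pos w hw)) (by norm_num)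
  have hr1 : r < 1 := (min_le_right _ _).trans_lt (by norm_num)
  have hnn : ∀ v ∈ C, 0 ≤ a v - r * γ v := by
    intro v hv
    have h1 : r ≤ a v / γ v := (min_le_left _ _).trans (hmin v hv)
    rw [le_div_iff₀ (hC.pos v hv)] at h1
    linarith
  have hz : ∑ v ∈ C, ((a v - r * γ v) / (1 - r)) • v ∈ P := by
    refine hP.sum_mem (fun v hv => div_nonneg (hnn v hv) (by linarith)) ?_ hCP
    rw [← Finset.sum_div, Finset.sum_sub_distrib, ← Finset.mul_sum, ha1, hC.sum, mul_one]
    exact div_self (by linarith)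
  have h := hP.combo_interior_self_mem_interior h0 hz hr0 (by linarith : 0 ≤ 1 - r) (by ring)
  convert h using 1
  rw [smul_zero, zero_add, Finset.smul_sum]
  have hr2 : 1 - r ≠ 0 := by linarith
  have : ∀ v ∈ C, (1 - r) • ((a v - r * γ v) / (1 - r)) • v = a v • v - r • γ v • v := by
    intro v _
    rw [smul_smul, mul_div_cancel₀ _ hr2, sub_smul, mul_smul]
  rw [Finset.sum_congr rfl this, Finset.sum_sub_distrib, ← Finset.smul_sum, hC.zero, smul_zero,
    sub_zero]

lemma IsCanonicalFano.convex {d : ℕ} {P : Set (Fin d → ℝ)} (hP : IsCanonicalFano P) :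
    Convex ℝ P := by
  obtain ⟨⟨V, -, rfl⟩, -⟩ := hP
  exact convex_convexHull ℝ _

lemma IsCanonicalFano.zero_mem_interior {d : ℕ} {P : Set (Fin d → ℝ)} (hP : IsCanonicalFano P) :
    0 ∈ interior P := by
  have : (0 : Fin d → ℝ) ∈ {x ∈ interior P | IsLatticePt x} := by rw [hP.2]; rfl
  exact this.1

/-- The product-sum inequality for barycentric coordinates of the unique interior lattice point. -/
theorem IsCirc.prod_le {d : ℕ} {P : Set (Fin d → ℝ)} (hP : IsCanonicalFano P)
    {C : Finset (Fin d → ℝ)} {γ : (Fin d → ℝ) → ℝ} (hC : IsCirc C γ) (hCP : ∀ v ∈ C, v ∈ P)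
    (hlat : ∀ v ∈ C, IsLatticePt v) {J K : Finset (Fin d → ℝ)} (hJK : Disjoint J K)
    (hCJK : C = J ∪ K) (hK : K.Nonempty) :
    ∏ v ∈ J, γ v ≤ ∑ v ∈ K, γ v := by
  by_contra! hlt
  have hJC : ∀ v ∈ J, v ∈ C := fun v hv => by rw [hCJK]; exact Finset.mem_union_left _ hv
  have hKC : ∀ v ∈ K, v ∈ C := fun v hv => by rw [hCJK]; exact Finset.mem_union_right _ hv
  have hsum : ∑ v ∈ J, γ v + ∑ v ∈ K, γ v = 1 := by
    rw [← Finset.sum_union hJK, ← hCJK, hC.sum]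
  have hKpos : 0 < ∑ v ∈ K, γ v := Finset.sum_pos (fun v hv => hC.pos v (hKC v hv)) hK
  have hJs : ∑ i : J, γ i = ∑ v ∈ J, γ v := Finset.sum_coe_sort J γ
  obtain ⟨p₀, hp₀, hp₀'⟩ := exists_int_approx (ι := J) (β := fun v => γ v)
    (fun i => hC.pos i (hJC i i.2)) (by rw [hJs]; linarith)
    (by rw [hJs, Finset.prod_coe_sort J γ]; linarith)
  obtain ⟨p, hp, hp', hps⟩ : ∃ p : J → ℤ, p ≠ 0 ∧
      (∀ i, |(p i : ℝ) - γ i * ∑ j, (p j : ℝ)| < γ i) ∧ 0 ≤ ∑ j, (p j : ℝ) := by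
    rcases le_total 0 (∑ j, (p₀ j : ℝ)) with h | h
    · exact ⟨p₀, hp₀, hp₀', h⟩
    · refine ⟨-p₀, neg_ne_zero.mpr hp₀, fun i => ?_, ?_⟩
      · rw [← abs_neg]
        convert hp₀' i using 2
        simp
        ring
      · simpa using h
  classical
  set q : (Fin d → ℝ) → ℤ := fun v => if h : v ∈ J then p ⟨v, h⟩ else 0 with hq
  have hqJ : ∀ i : J, q i = p i := fun i => by simp [hq]
  have hqK : ∀ v ∈ K, q v = 0 := fun v hv => by
    simp [hq, Finset.disjoint_right.mp hJK hv]
  have hqs : ∑ v ∈ C, (q v : ℝ) = ∑ j, (p j : ℝ) := by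
    rw [hCJK, Finset.sum_union hJK, Finset.sum_eq_zero (s := K) fun v hv => by simp [hqK v hv],
      add_zero, ← Finset.sum_coe_sort J]
    simp [hqJ]
  set s := ∑ j, (p j : ℝ) with hs
  have hapos : ∀ v ∈ C, 0 < (1 + s) * γ v - q v := by
    intro v hv
    have hg := hC.pos v hv
    by_cases hvJ : v ∈ J
    · have h1 := (abs_lt.mp (hp' ⟨v, hvJ⟩)).2
      rw [← hqJ ⟨v, hvJ⟩] at h1
      simp only at h1
      linarith
    · have hvK : v ∈ K := by
        rw [hCJK] at hv; exact (Finset.mem_union.mp hv).resolve_left hvJ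
      rw [hqK v hvK]
      simp only [Int.cast_zero, sub_zero]
      positivity
  have hmem := hC.mem_interior hP.convex hP.zero_mem_interior hCP hapos (by
    rw [Finset.sum_sub_distrib, ← Finset.mul_sum, hC.sum, hqs]; ring)
  have hx : ∑ v ∈ C, ((1 + s) * γ v - q v) • v = -∑ v ∈ C, (q v : ℝ) • v := by
    simp_rw [sub_smul, mul_smul]
    rw [Finset.sum_sub_distrib, ← Finset.smul_sum, hC.zero, smul_zero, zero_sub]
  rw [hx] at hmem
  have hxl : IsLatticePt (-∑ v ∈ C, (q v : ℝ) • v) := by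
    choose! z hz using hlat
    intro i
    refine ⟨-∑ v ∈ C, q v * z v i, ?_⟩
    simp only [Pi.neg_apply, Finset.sum_apply, Pi.smul_apply, smul_eq_mul]
    push_cast
    rw [Finset.sum_congr rfl fun v hv => by rw [hz v hv i]]
  have h0 : -∑ v ∈ C, (q v : ℝ) • v ∈ ({0} : Set (Fin d → ℝ)) := by
    rw [← hP.2]; exact ⟨hmem, hxl⟩
  rw [Set.mem_singleton_iff, neg_eq_zero] at h0
  obtain ⟨l, hl⟩ := hC.unique (fun v => q v) h0
  obtain ⟨k, hk⟩ := hK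
  have hl0 : l = 0 := by
    have := hl k (hKC k hk)
    rw [hqK k hk, Int.cast_zero] at this
    exact (mul_eq_zero.mp this.symm).resolve_right (hC.pos k (hKC k hk)).ne'
  apply hp
  ext i
  have := hl i (hJC i i.2)
  rw [hl0, zero_mul, hqJ] at this
  exact_mod_cast this

lemma exists_antitone_enumeration {E : Type*} [Nonempty E] [DecidableEq E] (γ : E → ℝ) (n : ℕ)
    (C : Finset E) (hC : C.card = n) :
    ∃ c : ℕ → E, Set.InjOn c (Finset.range n) ∧ (Finset.range n).image c = C ∧
      ∀ i j, i ≤ j → j < n → γ (c j) ≤ γ (c i) := by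
  induction n generalizing C with
  | zero =>
    rw [Finset.card_eq_zero] at hC
    subst hC
    exact ⟨fun _ => Classical.arbitrary E, by simp, by simp, by simp⟩
  | succ n ih =>
    have hne : C.Nonempty := by rw [← Finset.card_pos]; omega
    obtain ⟨g, hg, hmin⟩ := Finset.exists_min_image C γ hne
    obtain ⟨c, hinj, him, hanti⟩ := ih (C.erase g) (by rw [Finset.card_erase_of_mem hg, hC]; rfl)
    have hmem : ∀ i < n, c i ∈ C.erase g := fun i hi => by
      rw [← him]; exact Finset.mem_image_of_mem _ (Finset.mem_range.mpr hi)
    have hu : ∀ i < n, Function.update c n g i = c i := fun i hi =>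
      Function.update_of_ne hi.ne _ _
    refine ⟨Function.update c n g, ?_, ?_, ?_⟩
    · intro i hi j hj hij
      simp only [Finset.coe_range, Set.mem_Iio] at hi hj
      rcases Nat.lt_succ_iff_lt_or_eq.mp hi with h1 | rfl <;>
        rcases Nat.lt_succ_iff_lt_or_eq.mp hj with h2 | h2
      · rw [hu i h1, hu j h2] at hij
        exact hinj (by simpa using h1) (by simpa using h2) hij
      · subst h2
        rw [hu i h1, Function.update_self] at hij
        exact absurd hij (Finset.ne_of_mem_erase (hmem i h1))
      · rw [hu j h2, Function.update_self] at hij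
        exact absurd hij.symm (Finset.ne_of_mem_erase (hmem j h2))
      · exact h2.symm
    · rw [Finset.range_add_one, Finset.image_insert, Function.update_self,
        Finset.image_congr (g := c) fun i hi => hu i (by simpa using hi), him,
        Finset.insert_erase hg]
    · intro i j hij hj
      rcases Nat.lt_succ_iff_lt_or_eq.mp hj with h1 | rfl
      · rw [hu j h1, hu i (hij.trans_lt h1)]
        exact hanti i j hij h1
      · rcases hij.lt_or_eq with h2 | rfl
        · rw [Function.update_self, hu i h2]
          exact hmin _ (Finset.mem_of_mem_erase (hmem i h2))
        · exact le_rfl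

/-- The product-sum inequalities between the weights of a finite set. -/
def ProdLeSum {E : Type*} [DecidableEq E] (C : Finset E) (γ : E → ℝ) : Prop :=
  ∀ J K : Finset E, Disjoint J K → C = J ∪ K → K.Nonempty → ∏ v ∈ J, γ v ≤ ∑ v ∈ K, γ v

/-- The weights of a finite set satisfying the product-sum inequalities, in decreasing order, form
a weight sequence. -/
lemma ProdLeSum.isWeightSeq {E : Type*} [DecidableEq E] {C : Finset E} {γ : E → ℝ}
    (h : ProdLeSum C γ) (hpos : ∀ v ∈ C, 0 < γ v) (hsum : ∑ v ∈ C, γ v = 1) {s : ℕ} {c : ℕ → E}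
    (hinj : Set.InjOn c (Finset.range (s + 1))) (him : (Finset.range (s + 1)).image c = C)
    (hanti : ∀ i j, i ≤ j → j < s + 1 → γ (c j) ≤ γ (c i)) :
    IsWeightSeq s fun i => γ (c i) where
  pos i hi := hpos _ (by
    rw [← him]; exact Finset.mem_image_of_mem _ (Finset.mem_range.mpr (by omega)))
  anti i hi := hanti i (i + 1) (by omega) (by omega)
  sum := by rw [← hsum, ← him, Finset.sum_image hinj, Finset.range_eq_Ico]
  prod_le j hj1 hj := by
    have hr : Finset.range (s + 1) = Finset.range j ∪ Finset.Ico j (s + 1) := by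
      ext i; simp; omega
    have hd : Disjoint (Finset.range j) (Finset.Ico j (s + 1)) := by
      rw [Finset.disjoint_left]; intro i; simp; omega
    have hJ : Set.InjOn c (Finset.range j) :=
      hinj.mono (by rw [hr]; exact_mod_cast Finset.subset_union_left)
    have hK : Set.InjOn c (Finset.Ico j (s + 1)) :=
      hinj.mono (by rw [hr]; exact_mod_cast Finset.subset_union_right)
    have := h ((Finset.range j).image c) ((Finset.Ico j (s + 1)).image c) ?_ ?_ ?_
    · rwa [Finset.prod_image hJ, Finset.sum_image hK] at this
    · rw [Finset.disjoint_left]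
      intro v hv hv'
      obtain ⟨i, hi, rfl⟩ := Finset.mem_image.mp hv
      obtain ⟨k, hk, hki⟩ := Finset.mem_image.mp hv'
      have : k = i := hinj (by rw [hr]; exact_mod_cast Finset.mem_union_right _ hk)
        (by rw [hr]; exact_mod_cast Finset.mem_union_left _ hi) hki
      subst this
      exact Finset.disjoint_left.mp hd hi hk
    · rw [← him, hr, Finset.image_union]
    · exact ⟨c j, Finset.mem_image_of_mem _ (by simp; omega)⟩

section

variable {E : Type*} [DecidableEq E] {C : Finset E} {γ : E → ℝ} {s : ℕ}

lemma ProdLeSum.exists_enumeration (h : ProdLeSum C γ) (hpos : ∀ v ∈ C, 0 < γ v)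
    (hsum : ∑ v ∈ C, γ v = 1) (hs : C.card = s + 1) {g : E} (hg : g ∈ C)
    (hmin : ∀ v ∈ C, γ g ≤ γ v) :
    ∃ c : ℕ → E, Set.InjOn c (Finset.range (s + 1)) ∧ (Finset.range (s + 1)).image c = C ∧
      IsWeightSeq s (fun i => γ (c i)) ∧
      ∏ v ∈ C.erase g, γ v = ∏ i ∈ Finset.range s, γ (c i) := by
  have : Nonempty E := ⟨g⟩
  obtain ⟨c, hinj, him, hanti⟩ := exists_antitone_enumeration γ (s + 1) C hs
  refine ⟨c, hinj, him, h.isWeightSeq hpos hsum hinj him hanti, ?_⟩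
  have hgs : γ (c s) = γ g := by
    apply le_antisymm
    · rw [← him] at hg
      obtain ⟨i, hi, rfl⟩ := Finset.mem_image.mp hg
      exact hanti i s (by simp at hi; omega) (by omega)
    · exact hmin _ (by rw [← him]; exact Finset.mem_image_of_mem _ (by simp))
  have h1 : (∏ v ∈ C.erase g, γ v) * γ g = (∏ i ∈ Finset.range s, γ (c i)) * γ g := by
    rw [Finset.prod_erase_mul _ _ hg, ← hgs, ← Finset.prod_range_succ (fun i => γ (c i)),
      ← Finset.prod_image hinj, him]
  exact mul_right_cancel₀ (hpos g hg).ne' h1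

lemma ProdLeSum.prod_erase_ge (h : ProdLeSum C γ) (hpos : ∀ v ∈ C, 0 < γ v)
    (hsum : ∑ v ∈ C, γ v = 1) (hs : C.card = s + 1) (hs1 : 1 ≤ s) {g : E} (hg : g ∈ C)
    (hmin : ∀ v ∈ C, γ g ≤ γ v) : 1 / (simplexBound s : ℝ) ≤ ∏ v ∈ C.erase g, γ v := by
  obtain ⟨c, -, -, hw, hp⟩ := h.exists_enumeration hpos hsum hs hg hmin
  rw [hp]
  exact hw.prod_ge hs1

lemma ProdLeSum.second_smallest_ge (h : ProdLeSum C γ) (hpos : ∀ v ∈ C, 0 < γ v)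
    (hsum : ∑ v ∈ C, γ v = 1) (hs : C.card = s + 1) (hs1 : 1 ≤ s) {a b : E} (ha : a ∈ C)
    (hb : b ∈ C) (hab : a ≠ b) (hba : γ b ≤ γ a) : 1 / (2 * sylvPred (s - 1) : ℝ) ≤ γ a := by
  have : Nonempty E := ⟨a⟩
  obtain ⟨c, hinj, him, hanti⟩ := exists_antitone_enumeration γ (s + 1) C hs
  have hw := h.isWeightSeq hpos hsum hinj him hanti
  refine (hw.second_smallest_ge hs1).trans ?_
  rw [← him] at ha hb
  obtain ⟨i, hi, rfl⟩ := Finset.mem_image.mp ha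
  obtain ⟨j, hj, rfl⟩ := Finset.mem_image.mp hb
  simp only [Finset.mem_range] at hi hj
  have hij : i ≠ j := fun h => hab (by rw [h])
  by_cases his : i = s
  · exact (hanti j (s - 1) (by omega) (by omega)).trans hba
  · exact hanti i (s - 1) (by omega) (by omega)

end

section

variable {E : Type*} [AddCommGroup E] [Module ℝ E]

/-- Some combination of the elements of `W` with positive coefficients lies in `U`. -/
def PosDep (U : Submodule ℝ E) (W : Finset E) : Prop :=
  ∃ γ : E → ℝ, (∀ v ∈ W, 0 < γ v) ∧ ∑ v ∈ W, γ v • v ∈ U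

lemma posDep_filter {U : Submodule ℝ E} {W : Finset E} {γ : E → ℝ} (h0 : ∀ v ∈ W, 0 ≤ γ v)
    (h : ∑ v ∈ W, γ v • v ∈ U) : PosDep U {v ∈ W | 0 < γ v} := by
  refine ⟨γ, fun v hv => (Finset.mem_filter.mp hv).2, ?_⟩
  rwa [Finset.sum_filter_of_ne]
  intro v hv hne
  exact (h0 v hv).lt_of_ne fun h => hne (by rw [← h, zero_smul])

lemma PosDep.nonpos_of_minimal {U : Submodule ℝ E} {C Z : Finset E} (hC : PosDep U C)
    (hmin : ∀ C' ⊆ C, Z ⊆ C' → PosDep U C' → C' = C) (hZ : Z ⊆ C) (hZne : Z.Nonempty)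
    {δ : E → ℝ} (hδ : ∑ v ∈ C, δ v • v ∈ U) (hδZ : ∀ v ∈ Z, δ v = 0) : ∀ v ∈ C, δ v ≤ 0 := by
  obtain ⟨α, hα, hαU⟩ := hC
  obtain ⟨w, hw, hmax⟩ := Finset.exists_max_image C (fun v => δ v / α v) (hZne.mono hZ)
  by_contra! hcon
  obtain ⟨v₁, hv₁, hpos⟩ := hcon
  have hl : 0 < δ w / α w := (div_pos hpos (hα v₁ hv₁)).trans_le (hmax v₁ hv₁)
  have hne : δ w / α w ≠ 0 := hl.ne'
  have key := hmin {v ∈ C | 0 < α v - (δ w / α w)⁻¹ * δ v} (Finset.filter_subset _ _) ?_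
    (posDep_filter (γ := fun v => α v - (δ w / α w)⁻¹ * δ v) ?_ ?_)
  · have h1 := hw
    rw [← key, Finset.mem_filter] at h1
    have h2 := hα w hw
    have h3 : δ w ≠ 0 := by rintro h; simp [h] at hl
    have : α w - (δ w / α w)⁻¹ * δ w = 0 := by field_simp; ring
    linarith [h1.2]
  · intro v hv
    rw [Finset.mem_filter, hδZ v hv, mul_zero, sub_zero]
    exact ⟨hZ hv, hα v (hZ hv)⟩
  · intro v hv
    have h1 := hmax v hv
    rw [div_le_iff₀ (hα v hv)] at h1
    rw [sub_nonneg, inv_mul_le_iff₀ hl]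
    exact h1
  · simp_rw [sub_smul, mul_smul]
    rw [Finset.sum_sub_distrib, ← Finset.smul_sum]
    exact U.sub_mem hαU (U.smul_mem _ hδ)

lemma PosDep.eq_zero_of_minimal {U : Submodule ℝ E} {C Z : Finset E} (hC : PosDep U C)
    (hmin : ∀ C' ⊆ C, Z ⊆ C' → PosDep U C' → C' = C) (hZ : Z ⊆ C) (hZne : Z.Nonempty)
    {δ : E → ℝ} (hδ : ∑ v ∈ C, δ v • v ∈ U) (hδZ : ∀ v ∈ Z, δ v = 0) : ∀ v ∈ C, δ v = 0 := by
  intro v hv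
  refine le_antisymm (hC.nonpos_of_minimal hmin hZ hZne hδ hδZ v hv) ?_
  have h := hC.nonpos_of_minimal hmin hZ hZne (δ := fun v => -δ v) (by
    simpa [neg_smul, Finset.sum_neg_distrib] using hδ) (fun v hv => by simp [hδZ v hv]) v hv
  linarith

/-- Every vector in the span of a positively dependent set is a positive combination of it. -/
lemma PosDep.exists_pos_combination {A : Finset E} (hA : PosDep ⊥ A) {u : E}
    (hu : u ∈ Submodule.span ℝ (A : Set E)) :
    ∃ β : E → ℝ, (∀ v ∈ A, 0 < β v) ∧ ∑ v ∈ A, β v • v = u := by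
  obtain ⟨α, hα, hα0⟩ := hA
  rw [Submodule.mem_bot] at hα0
  obtain ⟨c, -, hc⟩ := Submodule.mem_span_finset.mp hu
  obtain ⟨M, hM⟩ := (A.image fun v => -c v / α v).bddAbove
  refine ⟨fun v => c v + (M + 1) * α v, fun v hv => ?_, ?_⟩
  · have h1 : -c v / α v ≤ M := hM (by
      exact_mod_cast Finset.mem_image_of_mem (fun v => -c v / α v) hv)
    rw [div_le_iff₀ (hα v hv)] at h1
    nlinarith [hα v hv]
  · simp_rw [add_smul, mul_smul]
    rw [Finset.sum_add_distrib, ← Finset.smul_sum, hα0, smul_zero, add_zero, hc]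

lemma IsCirc.posDep {C : Finset E} {γ : E → ℝ} (h : IsCirc C γ) : PosDep ⊥ C :=
  ⟨γ, h.pos, by rw [Submodule.mem_bot, h.zero]⟩

lemma IsCirc.linearIndependent [DecidableEq E] {C : Finset E} {γ : E → ℝ} (h : IsCirc C γ) {g : E}
    (hg : g ∈ C) : LinearIndependent ℝ (fun v : C.erase g => (v : E)) := by
  rw [Fintype.linearIndependent_iff]
  intro a ha i
  set δ : E → ℝ := fun v => if h : v ∈ C.erase g then a ⟨v, h⟩ else 0 with hδ
  have h1 : ∑ v ∈ C, δ v • v = 0 := by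
    rw [← Finset.sum_erase_add _ _ hg, show δ g = 0 by simp [hδ], zero_smul, add_zero,
      ← Finset.sum_coe_sort (C.erase g), ← ha]
    exact Finset.sum_congr rfl fun v _ => by simp only [hδ, v.2, dif_pos]
  obtain ⟨l, hl⟩ := h.unique δ h1
  have hl0 : l = 0 := by
    have h2 := hl g hg
    rw [show δ g = 0 by simp [hδ]] at h2
    exact (mul_eq_zero.mp h2.symm).resolve_right (h.pos g hg).ne'
  have h3 := hl i (Finset.mem_of_mem_erase i.2)
  rw [hl0, zero_mul] at h3
  rw [← h3, hδ]
  simp only [i.2, dif_pos]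

lemma IsCirc.nonempty {C : Finset E} {γ : E → ℝ} (h : IsCirc C γ) : C.Nonempty := by
  rw [Finset.nonempty_iff_ne_empty]
  rintro rfl
  simpa using h.sum

lemma IsCirc.mem_span_erase [DecidableEq E] {C : Finset E} {γ : E → ℝ} (h : IsCirc C γ) {g : E}
    (hg : g ∈ C) : g ∈ Submodule.span ℝ (C.erase g : Set E) := by
  have h1 := h.zero
  rw [← Finset.add_sum_erase _ _ hg, add_eq_zero_iff_eq_neg] at h1
  have h2 : γ g • g ∈ Submodule.span ℝ (C.erase g : Set E) := by
    rw [h1]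
    refine Submodule.neg_mem _ (Submodule.sum_mem _ fun v hv => Submodule.smul_mem _ _ ?_)
    exact Submodule.subset_span hv
  exact (Submodule.smul_mem_iff _ (h.pos g hg).ne').mp h2

lemma IsCirc.finrank_add_one {C : Finset E} {γ : E → ℝ} (h : IsCirc C γ) :
    Module.finrank ℝ (Submodule.span ℝ (C : Set E)) + 1 = C.card := by
  classical
  obtain ⟨g, hg⟩ := h.nonempty
  have h1 := finrank_span_eq_card (h.linearIndependent hg)
  have h2 : Submodule.span ℝ (C : Set E) = Submodule.span ℝ (C.erase g : Set E) := by
    conv_lhs => rw [← Finset.insert_erase hg, Finset.coe_insert,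
      Submodule.span_insert_eq_span (h.mem_span_erase hg)]
  rw [h2]
  have h3 : Set.range (fun v : C.erase g => (v : E)) = (C.erase g : Set E) := by
    ext; simp [and_comm]
  rw [h3, Fintype.card_coe, Finset.card_erase_of_mem hg] at h1
  rw [h1]
  have := Finset.card_pos.mpr ⟨g, hg⟩
  omega

/-- Over a positively dependent subset `A'` of maximal smaller dimension, a positively dependent
set contains a circuit whose part `W` spans a complement in a minimal way. -/
lemma exists_circuit_extension [DecidableEq E] {A A' : Finset E} (hA : PosDep ⊥ A)
    (hA' : PosDep ⊥ A') (hsub : A' ⊆ A)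
    (hlt : Module.finrank ℝ (Submodule.span ℝ (A' : Set E)) <
      Module.finrank ℝ (Submodule.span ℝ (A : Set E)))
    (hmax : ∀ B ⊆ A, PosDep ⊥ B → Module.finrank ℝ (Submodule.span ℝ (B : Set E)) <
      Module.finrank ℝ (Submodule.span ℝ (A : Set E)) →
      Module.finrank ℝ (Submodule.span ℝ (B : Set E)) ≤
      Module.finrank ℝ (Submodule.span ℝ (A' : Set E))) :
    ∃ (W C : Finset E) (γ : E → ℝ), C ⊆ A ∧ W ⊆ C ∧ IsCirc C γ ∧
      W.card + Module.finrank ℝ (Submodule.span ℝ (A' : Set E)) =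
        Module.finrank ℝ (Submodule.span ℝ (A : Set E)) + 1 ∧
      ∀ b ∈ W, LinearIndependent ℝ
        (fun w : W.erase b => (Submodule.Quotient.mk (w : E) :
          E ⧸ Submodule.span ℝ (A' : Set E))) := by
  classical
  have : FiniteDimensional ℝ (Submodule.span ℝ (A : Set E)) :=
    FiniteDimensional.span_of_finite ℝ A.finite_toSet
  set U := Submodule.span ℝ (A' : Set E) with hU
  have hW₀ : {v ∈ A | v ∉ U}.Nonempty ∧ PosDep U {v ∈ A | v ∉ U} := by
    constructor
    · by_contra hemp
      rw [Finset.not_nonempty_iff_eq_empty, Finset.filter_eq_empty_iff] at hemp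
      have hle : Submodule.span ℝ (A : Set E) ≤ U :=
        Submodule.span_le.mpr fun v hv => not_not.mp (hemp hv)
      have := FiniteDimensional.span_of_finite ℝ A'.finite_toSet
      exact absurd (Submodule.finrank_mono hle) (by omega)
    · obtain ⟨α, hα, hα0⟩ := hA
      refine ⟨α, fun v hv => hα v (Finset.mem_filter.mp hv).1, ?_⟩
      rw [Submodule.mem_bot, ← Finset.sum_filter_add_sum_filter_not A (· ∉ U)] at hα0
      rw [eq_neg_of_add_eq_zero_left hα0]
      refine U.neg_mem (U.sum_mem fun v hv => U.smul_mem _ ?_)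
      exact not_not.mp (Finset.mem_filter.mp hv).2
  obtain ⟨W, hWsub, ⟨hWne, hWdep⟩, hWmin⟩ :=
    exists_minimal_le_of_wellFoundedLT (fun W : Finset E => W.Nonempty ∧ PosDep U W) _ hW₀
  have hWA : ∀ v ∈ W, v ∈ A := fun v hv => (Finset.mem_filter.mp (hWsub hv)).1
  have hWU : ∀ v ∈ W, v ∉ U := fun v hv => (Finset.mem_filter.mp (hWsub hv)).2
  have huniq : ∀ v₀ ∈ W, ∀ δ : E → ℝ, ∑ v ∈ W, δ v • v ∈ U → δ v₀ = 0 → ∀ v ∈ W, δ v = 0 := by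
    intro v₀ hv₀ δ hδ hδ0
    refine hWdep.eq_zero_of_minimal (Z := {v₀}) ?_ (by simpa using hv₀) (by simp) hδ (by simpa)
    intro C' hC' hZ hdep
    exact hC'.antisymm (hWmin ⟨⟨v₀, hZ (by simp)⟩, hdep⟩ hC')
  have hli : ∀ b ∈ W, LinearIndependent ℝ
      (fun w : W.erase b => (Submodule.Quotient.mk (w : E) : E ⧸ U)) := by
    intro b hb
    rw [Fintype.linearIndependent_iff]
    intro a ha i
    set δ : E → ℝ := fun v => if h : v ∈ W.erase b then a ⟨v, h⟩ else 0 with hδ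
    have hb0 : δ b = 0 := by simp [hδ]
    have h1 : ∑ v ∈ W, δ v • v ∈ U := by
      rw [← Submodule.Quotient.mk_eq_zero, ← Finset.sum_erase_add _ _ hb, hb0, zero_smul, add_zero,
        ← Finset.sum_coe_sort (W.erase b), ← ha, ← Submodule.mkQ_apply, map_sum]
      refine Finset.sum_congr rfl fun v _ => ?_
      rw [map_smul, Submodule.mkQ_apply]
      congr 1
      simp only [hδ, v.2, dif_pos]
    have h3 := huniq b hb δ h1 hb0 i (Finset.mem_of_mem_erase i.2)
    rw [← h3, hδ]
    simp only [i.2, dif_pos]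
  obtain ⟨γ, hγ, hγU⟩ := hWdep
  have hdisj : Disjoint A' W := Finset.disjoint_left.mpr fun v hv hvW =>
    hWU v hvW (Submodule.subset_span hv)
  have hunion : PosDep ⊥ (A' ∪ W) := by
    obtain ⟨β, hβ, hβs⟩ := hA'.exists_pos_combination (U.neg_mem hγU)
    refine ⟨fun v => if v ∈ W then γ v else β v, fun v hv => ?_, ?_⟩
    · by_cases h : v ∈ W
      · simpa [h] using hγ v h
      · simpa [h] using hβ v ((Finset.mem_union.mp hv).resolve_right h)
    · rw [Submodule.mem_bot, Finset.sum_union hdisj,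
        Finset.sum_congr rfl (g := fun v => β v • v) fun v hv => by
          simp [Finset.disjoint_left.mp hdisj hv],
        Finset.sum_congr (s₁ := W) rfl (g := fun v => γ v • v) fun v hv => by simp [hv], hβs]
      simp
  have hunionA : A' ∪ W ⊆ A := Finset.union_subset hsub hWA
  obtain ⟨C, hCsub, ⟨hCW, hCdep⟩, hCmin⟩ := exists_minimal_le_of_wellFoundedLT
    (fun C : Finset E => (∃ v ∈ C, v ∈ W) ∧ PosDep ⊥ C) (A' ∪ W)
    ⟨hWne.imp fun v hv => ⟨Finset.mem_union_right _ hv, hv⟩, hunion⟩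
  have hCU : ∀ v ∈ C, v ∉ W → v ∈ U := fun v hv hvW =>
    Submodule.subset_span ((Finset.mem_union.mp (hCsub hv)).resolve_right hvW)
  have hrestr : ∀ δ : E → ℝ, ∑ v ∈ C, δ v • v = 0 →
      ∑ v ∈ W, (if v ∈ C then δ v else 0) • v ∈ U := by
    intro δ hδ
    rw [← Finset.sum_filter_add_sum_filter_not C (· ∈ W)] at hδ
    have h1 : ∑ v ∈ W, (if v ∈ C then δ v else 0) • v = ∑ v ∈ C with v ∈ W, δ v • v := by
      simp_rw [ite_smul, zero_smul]
      rw [← Finset.sum_filter]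
      refine Finset.sum_congr ?_ fun _ _ => rfl
      ext v
      simp [and_comm]
    rw [h1, eq_neg_of_add_eq_zero_left hδ]
    refine U.neg_mem (U.sum_mem fun v hv => U.smul_mem _ ?_)
    rw [Finset.mem_filter] at hv
    exact hCU v hv.1 hv.2
  have hCdep' := hCdep
  obtain ⟨α, hα, hα0⟩ := hCdep
  rw [Submodule.mem_bot] at hα0
  have hWC : W ⊆ C := by
    intro v hv
    by_contra hvC
    obtain ⟨w, hwC, hwW⟩ := hCW
    have := huniq v hv _ (hrestr α hα0) (by simp [hvC]) w hwW
    simp only [hwC, if_true] at this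
    exact (hα w hwC).ne' this
  have hCcirc : ∀ δ : E → ℝ, ∑ v ∈ C, δ v • v = 0 → ∃ l : ℝ, ∀ v ∈ C, δ v = l * α v := by
    intro δ hδ
    obtain ⟨w, hw⟩ := hWne
    have hαw := hα w (hWC hw)
    set η : E → ℝ := fun v => δ v - δ w / α w * α v with hη
    have hη0 : ∑ v ∈ C, η v • v = 0 := by
      simp_rw [hη, sub_smul, mul_smul]
      rw [Finset.sum_sub_distrib, ← Finset.smul_sum, hα0, hδ]
      simp
    have hηW : ∀ v ∈ W, η v = 0 := by
      intro v hv
      have := huniq w hw _ (hrestr η hη0) (by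
        simp only [hη, div_mul_cancel₀ _ hαw.ne', sub_self, ite_self]) v hv
      simpa [hWC hv] using this
    have h := hCdep'.eq_zero_of_minimal (Z := W) (fun C' hC' hZ hdep =>
      hC'.antisymm (hCmin ⟨⟨w, hZ hw, hw⟩, hdep⟩ hC')) hWC ⟨w, hw⟩
      (by rw [Submodule.mem_bot]; exact hη0) hηW
    exact ⟨δ w / α w, fun v hv => sub_eq_zero.mp (h v hv)⟩
  have hαs : 0 < ∑ v ∈ C, α v := Finset.sum_pos hα (hWne.mono hWC)
  refine ⟨W, C, fun v => α v / ∑ v ∈ C, α v, hCsub.trans hunionA, hWC, ⟨?_, ?_, ?_, ?_⟩, ?_, hli⟩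
  · exact fun v hv => div_pos (hα v hv) hαs
  · rw [← Finset.sum_div, div_self hαs.ne']
  · simp_rw [div_eq_inv_mul, mul_smul]
    rw [← Finset.smul_sum, hα0, smul_zero]
  · intro δ hδ
    obtain ⟨l, hl⟩ := hCcirc δ hδ
    refine ⟨l * ∑ v ∈ C, α v, fun v hv => ?_⟩
    rw [hl v hv, mul_assoc, mul_div_cancel₀ _ hαs.ne']
  · obtain ⟨b, hb⟩ := hWne
    have hfd : FiniteDimensional ℝ U := FiniteDimensional.span_of_finite ℝ A'.finite_toSet
    have hfd2 : FiniteDimensional ℝ (Submodule.span ℝ ((A' ∪ W : Finset E) : Set E)) :=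
      FiniteDimensional.span_of_finite ℝ (A' ∪ W).finite_toSet
    have hfd3 : FiniteDimensional ℝ (Submodule.span ℝ ((W.erase b : Finset E) : Set E)) :=
      FiniteDimensional.span_of_finite ℝ (W.erase b).finite_toSet
    have hUle : U ≤ Submodule.span ℝ ((A' ∪ W : Finset E) : Set E) :=
      Submodule.span_mono (by simp)
    have hlt' : U < Submodule.span ℝ ((A' ∪ W : Finset E) : Set E) :=
      hUle.lt_of_ne fun h => hWU b hb (h ▸ Submodule.subset_span (by simp [hb]))
    have h1 := Submodule.finrank_lt_finrank_of_lt hlt'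
    have h2 : Module.finrank ℝ (Submodule.span ℝ ((A' ∪ W : Finset E) : Set E)) =
        Module.finrank ℝ (Submodule.span ℝ (A : Set E)) := by
      apply le_antisymm (Submodule.finrank_mono (Submodule.span_mono (by exact_mod_cast hunionA)))
      by_contra! h
      have := hmax _ hunionA hunion h
      omega
    have hbU : b ∈ U ⊔ Submodule.span ℝ ((W.erase b : Finset E) : Set E) := by
      have h3 : γ b • b ∈ U ⊔ Submodule.span ℝ ((W.erase b : Finset E) : Set E) := by
        rw [← Finset.add_sum_erase _ _ hb] at hγU
        rw [← add_sub_cancel_right (γ b • b) (∑ v ∈ W.erase b, γ v • v)]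
        refine Submodule.sub_mem _ (Submodule.mem_sup_left hγU) (Submodule.mem_sup_right ?_)
        exact Submodule.sum_mem _ fun v hv => Submodule.smul_mem _ _ (Submodule.subset_span hv)
      exact (Submodule.smul_mem_iff _ (hγ b hb).ne').mp h3
    have h4 : Submodule.span ℝ ((A' ∪ W : Finset E) : Set E) ≤
        U ⊔ Submodule.span ℝ ((W.erase b : Finset E) : Set E) := by
      rw [Submodule.span_le]
      intro v hv
      rcases Finset.mem_union.mp (by exact_mod_cast hv) with h | h
      · exact Submodule.mem_sup_left (Submodule.subset_span h)
      · by_cases hvb : v = b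
        · exact hvb ▸ hbU
        · exact Submodule.mem_sup_right (Submodule.subset_span (by simp [h, hvb]))
    have h5 := (Submodule.finrank_mono h4).trans
      (Submodule.finrank_add_le_finrank_add_finrank U _)
    have h6 : Module.finrank ℝ (Submodule.span ℝ ((W.erase b : Finset E) : Set E)) ≤
        (W.erase b).card := finrank_span_finset_le_card _
    rw [Finset.card_erase_of_mem hb] at h6
    have hWpos := Finset.card_pos.mpr ⟨b, hb⟩
    have h7 : Module.finrank ℝ U + (W.card - 1) ≤
        Module.finrank ℝ (Submodule.span ℝ (A : Set E)) := by
      have hind := LinearIndependent.sumElim_of_quotient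
        (Module.finBasis ℝ U).linearIndependent (fun w : W.erase b => (w : E)) (hli b hb)
      have h8 := finrank_span_eq_card hind
      rw [Fintype.card_sum, Fintype.card_fin, Fintype.card_coe, Finset.card_erase_of_mem hb] at h8
      rw [← h8]
      apply Submodule.finrank_mono
      rw [Submodule.span_le]
      rintro _ ⟨i | i, rfl⟩
      · exact Submodule.span_mono (by exact_mod_cast hsub) ((Module.finBasis ℝ U) i).2
      · exact Submodule.subset_span (hWA i (Finset.mem_of_mem_erase i.2))
    omega

end

/-- A bound for the normalized volume of the dual slice in dimension `k`. -/
def sliceBound (k : ℕ) : ℕ := if k = 3 then 109 else simplexBound k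

lemma sliceBound_of_four_le {k : ℕ} (hk : 4 ≤ k) : sliceBound k = 2 * sylvPred (k - 1) ^ 2 := by
  rw [sliceBound, if_neg (by omega), simplexBound, if_neg (by omega)]

lemma simplexBound_le_sliceBound (k : ℕ) : simplexBound k ≤ sliceBound k := by
  unfold sliceBound
  split_ifs with h
  · subst h; decide
  · exact le_rfl

lemma sliceBound_mono : Monotone sliceBound := by
  refine monotone_nat_of_le_succ fun n => ?_
  rcases lt_or_ge n 4 with h | h
  · interval_cases n <;> decide
  · rw [sliceBound_of_four_le h, sliceBound_of_four_le (by omega)]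
    have := sylvPred_mono (show n - 1 ≤ n + 1 - 1 by omega)
    gcongr

lemma two_pow_le_sylvPred (n : ℕ) : 2 ^ n ≤ sylvPred n := by
  induction n with
  | zero => decide
  | succ n ih =>
    rw [sylvPred, pow_succ]
    have : 1 ≤ sylvPred n := sylvPred_pos n
    gcongr
    omega

lemma choose_mul_sliceBound_le {k k' s : ℕ} (hs : 1 ≤ s) (hk' : s ≤ k') (hk : k' < k) {B : ℕ}
    (hB : B = simplexBound k' ∨ (B = sliceBound k' ∧ s < k')) :
    k.choose k' * B * (if k' + 1 = k then 2 * sylvPred (s - 1) else simplexBound s) + 1 ≤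
      sliceBound k := by
  have hBle : B ≤ sliceBound k' := by
    rcases hB with h | h
    · rw [h]; exact simplexBound_le_sliceBound _
    · rw [h.1]
  rcases lt_or_ge k 5 with h5 | h5
  · interval_cases k <;> interval_cases k' <;> interval_cases s <;>
      (rcases hB with rfl | ⟨rfl, h⟩ <;> first | decide | (exfalso; omega))
  obtain ⟨n, rfl⟩ : ∃ n, k = n + 5 := ⟨k - 5, by omega⟩
  rw [sliceBound_of_four_le (show 4 ≤ n + 5 by omega)]
  split_ifs with h1
  · obtain rfl : k' = n + 4 := by omega
    rw [sliceBound_of_four_le (by omega)] at hBle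
    have h2 : sylvPred (s - 1) ≤ sylvPred (n + 3) := sylvPred_mono (by omega)
    have h3 : (n + 5).choose (n + 4) = n + 5 := by
      rw [← Nat.choose_symm_of_eq_add (show n + 5 = 1 + (n + 4) by omega), Nat.choose_one_right]
    have h4 := sylvPred_lower (show 3 ≤ n + 3 by omega)
    have h6 : sylvPred (n + 5 - 1) = sylvPred (n + 3) * (sylvPred (n + 3) + 1) := rfl
    rw [show n + 4 - 1 = n + 3 by omega] at hBle
    rw [h3, h6]
    set x := sylvPred (n + 3)
    have h7 : (n + 5) * B * (2 * sylvPred (s - 1)) ≤ (n + 5) * (2 * x ^ 2) * (2 * x) := by gcongr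
    have h8 : (n + 5) * (2 * x ^ 2) * (2 * x) ≤ x * (2 * x ^ 2) * (2 * x) := by gcongr; omega
    have h9 : 1 ≤ x := sylvPred_pos _
    nlinarith [Nat.pow_pos (n := 3) h9, Nat.pow_pos (n := 2) h9]
  · have hk2 : k' ≤ n + 3 := by omega
    have h2 : (n + 5).choose k' ≤ 2 ^ (n + 5) := by
      rw [← Nat.sum_range_choose]
      exact Finset.single_le_sum (f := fun i => (n + 5).choose i) (fun _ _ => Nat.zero_le _)
        (by simp; omega)
    have h3 : simplexBound s ≤ sliceBound (n + 3) :=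
      (simplexBound_le_sliceBound s).trans (sliceBound_mono (by omega))
    have h4 : B ≤ sliceBound (n + 3) := hBle.trans (sliceBound_mono hk2)
    have h6 : (n + 5).choose k' * B * simplexBound s ≤
        2 ^ (n + 5) * sliceBound (n + 3) * sliceBound (n + 3) := by gcongr
    refine (Nat.add_le_add_right h6 1).trans ?_
    rcases n with _ | n
    · decide
    rw [sliceBound_of_four_le (by omega)]
    have h7 := two_pow_le_sylvPred (n + 3)
    have h8 : sylvPred (n + 1 + 5 - 1) = (sylvPred (n + 3) * (sylvPred (n + 3) + 1)) *
      (sylvPred (n + 3) * (sylvPred (n + 3) + 1) + 1) := rfl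
    rw [h8, show n + 1 + 3 - 1 = n + 3 by omega]
    have h9 : 2 ^ (n + 1 + 5) = 8 * 2 ^ (n + 3) := by rw [pow_succ, pow_succ, pow_succ]; ring
    rw [h9]
    have h10 : 42 ≤ sylvPred (n + 3) := sylvPred_mono (show 3 ≤ n + 3 by omega)
    set x := sylvPred (n + 3)
    calc 8 * 2 ^ (n + 3) * (2 * x ^ 2) * (2 * x ^ 2) + 1
        ≤ 8 * x * (2 * x ^ 2) * (2 * x ^ 2) + 1 := by
          gcongr
      _ ≤ 2 * (x * x * (x * x)) ^ 2 := by
        have : 32 * x ^ 5 + x ^ 5 ≤ 2 * x ^ 8 := by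
          have h11 : 42 ^ 3 ≤ x ^ 3 := by gcongr
          calc 32 * x ^ 5 + x ^ 5 ≤ 2 * 42 ^ 3 * x ^ 5 := by
                nlinarith [pow_pos (by omega : 0 < x) 5]
            _ ≤ 2 * x ^ 3 * x ^ 5 := by gcongr
            _ = 2 * x ^ 8 := by ring
        nlinarith [pow_pos (by omega : 0 < x) 5]
      _ ≤ _ := by
        have : x * x ≤ x * (x + 1) := by nlinarith
        gcongr
        omega

section

variable {E : Type} [AddCommGroup E] [Module ℝ E]

/-- The values at the vectors `v` of the linear functionals bounded below by `-1` on `A`. -/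
def dualSlice {ι : Type} (A : Finset E) (v : ι → E) : Set (ι → ℝ) :=
  {t | ∃ y : E →ₗ[ℝ] ℝ, (∀ i, y (v i) = t i) ∧ ∀ w ∈ A, -1 ≤ y w}

lemma IsCirc.sum_erase_le [DecidableEq E] {C W : Finset E} {γ : E → ℝ} (h : IsCirc C γ)
    (hW : W ⊆ C) {y : E →ₗ[ℝ] ℝ} (hy : ∀ w ∈ C, -1 ≤ y w) :
    ∑ w ∈ W, γ w * (y w + 1) ≤ 1 := by
  have h1 : ∑ w ∈ C, γ w * (y w + 1) = 1 := by
    have h2 : ∑ w ∈ C, γ w * y w = 0 := by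
      have := congrArg y h.zero
      simpa [map_sum] using this
    simp_rw [mul_add, mul_one]
    rw [Finset.sum_add_distrib, h2, h.sum, zero_add]
  refine le_trans ?_ h1.le
  exact Finset.sum_le_sum_of_subset_of_nonneg hW fun w hw _ =>
    mul_nonneg (h.pos w hw).le (by linarith [hy w hw])

lemma IsCirc.dualSlice_subset [DecidableEq E] {A C W : Finset E} {γ : E → ℝ} (h : IsCirc C γ)
    (hCA : C ⊆ A) (hW : W ⊆ C) {t : W → ℝ} (ht : t ∈ dualSlice A (fun w : W => (w : E))) :
    t ∈ {u : W → ℝ | (∀ i, -1 ≤ u i) ∧ ∑ i : W, γ i * (u i + 1) ≤ 1} := by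
  obtain ⟨y, hy, hA⟩ := ht
  refine ⟨fun i => ?_, ?_⟩
  · rw [← hy i]; exact hA _ (hCA (hW i.2))
  · simp_rw [← hy]
    rw [Finset.sum_coe_sort W (fun w => γ w * (y w + 1))]
    exact h.sum_erase_le hW fun w hw => hA w (hCA hw)

lemma IsCirc.volume_dualSlice_le [DecidableEq E] {A C : Finset E} {γ : E → ℝ} (h : IsCirc C γ)
    (hCA : C ⊆ A) (hC : ProdLeSum C γ) {k : ℕ} (hk : 1 ≤ k) (hcard : C.card = k + 1) {g : E}
    (hg : g ∈ C) (hmin : ∀ v ∈ C, γ g ≤ γ v) :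
    volume (dualSlice A (fun w : C.erase g => (w : E))) ≤
      ENNReal.ofReal (simplexBound k / k.factorial) := by
  have hpos : ∀ i : C.erase g, 0 < γ i := fun i => h.pos _ (Finset.mem_of_mem_erase i.2)
  refine (measure_mono fun t ht => h.dualSlice_subset hCA (Finset.erase_subset g C) ht).trans ?_
  rw [volume_weighted_simplex hpos]
  apply ENNReal.ofReal_le_ofReal
  have h1 := hC.prod_erase_ge h.pos h.sum hcard hk hg hmin
  have h2 : (0 : ℝ) < simplexBound k := by exact_mod_cast simplexBound_pos k
  rw [Fintype.card_coe, Finset.card_erase_of_mem hg, hcard, Nat.add_sub_cancel,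
    Finset.prod_coe_sort (C.erase g) γ, ← div_div, div_right_comm]
  gcongr
  rwa [one_div_le (lt_of_lt_of_le (by positivity) h1) h2]

lemma ProdLeSum.one_div_prod_le [DecidableEq E] {C W : Finset E} {γ : E → ℝ} (h : IsCirc C γ)
    (hC : ProdLeSum C γ) {s : ℕ} (hs : 1 ≤ s) (hcard : C.card = s + 1) (hWC : W ⊆ C) {b : E}
    (hb : b ∈ W) (hmin : ∀ v ∈ W, γ b ≤ γ v) {p : Prop} [Decidable p] (hp : p → W.card = 2) :
    1 / ∏ w ∈ W.erase b, γ w ≤ ((if p then 2 * sylvPred (s - 1) else simplexBound s : ℕ) : ℝ) := by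
  have hsb : (0 : ℝ) < simplexBound s := by exact_mod_cast simplexBound_pos s
  split_ifs with h1
  · have h2 : (W.erase b).card = 1 := by rw [Finset.card_erase_of_mem hb, hp h1]
    obtain ⟨a, ha⟩ := Finset.card_eq_one.mp h2
    have haW : a ∈ W.erase b := by rw [ha]; simp
    rw [Finset.mem_erase] at haW
    rw [ha, Finset.prod_singleton]
    have h3 := hC.second_smallest_ge h.pos h.sum hcard hs (hWC haW.2) (hWC hb) haW.1
      (hmin a haW.2)
    have h4 := sylvPred_pos_real (s - 1)
    push_cast
    rwa [one_div_le (h.pos a (hWC haW.2)) (by positivity)]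
  · obtain ⟨g, hg, hgmin⟩ := Finset.exists_min_image C γ h.nonempty
    have key : ∏ v ∈ C.erase (if g ∈ W then b else g), γ v ≤ ∏ v ∈ W.erase b, γ v := by
      have hsub : W.erase b ⊆ C.erase (if g ∈ W then b else g) := by
        intro v hv
        obtain ⟨hvb, hvW⟩ := Finset.mem_erase.mp hv
        refine Finset.mem_erase.mpr ⟨?_, hWC hvW⟩
        split_ifs with hgW
        · exact hvb
        · exact fun h => hgW (h ▸ hvW)
      have hpos : ∀ v ∈ C.erase (if g ∈ W then b else g), 0 < γ v := fun v hv =>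
        h.pos v (Finset.mem_of_mem_erase hv)
      rw [← Finset.prod_sdiff hsub]
      refine mul_le_of_le_one_left (Finset.prod_pos fun v hv => hpos v (hsub hv)).le ?_
      refine Finset.prod_le_one (fun v hv => (hpos v (Finset.sdiff_subset hv)).le) fun v hv => ?_
      rw [← h.sum]
      exact Finset.single_le_sum (fun w hw => (h.pos w hw).le)
        (Finset.mem_of_mem_erase (Finset.sdiff_subset hv))
    have h2 : 1 / (simplexBound s : ℝ) ≤ ∏ v ∈ C.erase (if g ∈ W then b else g), γ v := by
      refine hC.prod_erase_ge h.pos h.sum hcard hs ?_ ?_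
      · split_ifs
        exacts [hWC hb, hg]
      · intro v hv
        split_ifs with hgW
        · exact (hmin g hgW).trans (hgmin v hv)
        · exact hgmin v hv
    rw [one_div_le (Finset.prod_pos fun v hv => h.pos v (hWC (Finset.mem_of_mem_erase hv))) hsb]
    exact h2.trans key

end

section

variable {E : Type} [AddCommGroup E] [Module ℝ E]

lemma volume_dualSlice_sum_le [DecidableEq E] {A A' W C : Finset E} {γ : E → ℝ} (h : IsCirc C γ)
    (hC : ProdLeSum C γ) (hsub : A' ⊆ A) (hCA : C ⊆ A) (hWC : W ⊆ C) {k k' s B : ℕ} (hs : 1 ≤ s)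
    (hs' : s ≤ k') (hk' : k' < k) (hcard : C.card = s + 1) (hWcard : W.card + k' = k + 1)
    (hB : B = simplexBound k' ∨ (B = sliceBound k' ∧ s < k')) {ι : Type} [Fintype ι] {v : ι → E}
    (hvol : volume (dualSlice A' v) ≤ ENNReal.ofReal (B / k'.factorial)) {b : E} (hb : b ∈ W)
    (hmin : ∀ v ∈ W, γ b ≤ γ v) :
    volume (dualSlice A (Sum.elim v fun w : W.erase b => (w : E))) ≤
      ENNReal.ofReal ((sliceBound k - 1) / k.factorial) := by
  have hpos : ∀ i : W.erase b, 0 < γ i := fun i => h.pos _ (hWC (Finset.mem_of_mem_erase i.2))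
  have hsub' : W.erase b ⊆ C := (Finset.erase_subset _ _).trans hWC
  refine (volume_sum_le (D₁ := dualSlice A' v) (D₂ := {u : W.erase b → ℝ | (∀ i, -1 ≤ u i) ∧
    ∑ i : W.erase b, γ i * (u i + 1) ≤ 1}) ?_).trans ?_
  · rintro t ⟨y, hy, hyA⟩
    refine ⟨⟨y, fun i => hy (Sum.inl i), fun w hw => hyA w (hsub hw)⟩, ?_⟩
    exact h.dualSlice_subset hCA hsub' ⟨y, fun i => hy (Sum.inr i), hyA⟩
  · rw [volume_weighted_simplex hpos]
    refine (mul_le_mul_left hvol _).trans ?_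
    rw [← ENNReal.ofReal_mul (by positivity)]
    apply ENNReal.ofReal_le_ofReal
    rw [Fintype.card_coe, Finset.card_erase_of_mem hb, Finset.prod_coe_sort (W.erase b) γ,
      show W.card - 1 = k - k' by omega]
    have h1 := hC.one_div_prod_le h hs hcard hWC hb hmin (p := k' + 1 = k) (fun _ => by omega)
    have h2 := choose_mul_sliceBound_le hs hs' hk' hB
    set G := (if k' + 1 = k then 2 * sylvPred (s - 1) else simplexBound s)
    have h3 : (k.choose k' : ℝ) * B * G + 1 ≤ sliceBound k := by exact_mod_cast h2
    have h4 : (k.choose k' : ℝ) * k'.factorial * (k - k').factorial = k.factorial := by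
      exact_mod_cast Nat.choose_mul_factorial_mul_factorial hk'.le
    have hf1 : (0 : ℝ) < k'.factorial := by exact_mod_cast Nat.factorial_pos _
    have hf2 : (0 : ℝ) < (k - k').factorial := by exact_mod_cast Nat.factorial_pos _
    have hch : (0 : ℝ) < k.choose k' := by exact_mod_cast Nat.choose_pos hk'.le
    calc (B : ℝ) / k'.factorial * (1 / ((k - k').factorial * ∏ w ∈ W.erase b, γ w))
        = B / (k'.factorial * (k - k').factorial) * (1 / ∏ w ∈ W.erase b, γ w) := by
          rw [div_mul_div_comm, div_mul_div_comm, mul_assoc]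
      _ ≤ B / (k'.factorial * (k - k').factorial) * G := by gcongr
      _ = (k.choose k' * B * G) / k.factorial := by rw [← h4]; field_simp
      _ ≤ _ := by gcongr; linarith

/-- Coordinates adapted to a positively dependent set in which its dual slice is small. -/
theorem exists_volume_dualSlice_le [DecidableEq E] {V : Finset E}
    (hV : ∀ C ⊆ V, ∀ γ, IsCirc C γ → ProdLeSum C γ) (k : ℕ) (hk : 1 ≤ k) (A : Finset E)
    (hAV : A ⊆ V) (hA : PosDep ⊥ A) (hAk : Module.finrank ℝ (Submodule.span ℝ (A : Set E)) = k) :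
    ∃ (ι : Type) (_ : Fintype ι) (v : ι → E), Fintype.card ι = k ∧ (∀ i, v i ∈ A) ∧
      LinearIndependent ℝ v ∧
      volume (dualSlice A v) ≤ ENNReal.ofReal (sliceBound k / k.factorial) ∧
      ((∀ C ⊆ A, ∀ γ, IsCirc C γ → C.card ≠ k + 1) →
        volume (dualSlice A v) ≤ ENNReal.ofReal ((sliceBound k - 1) / k.factorial)) := by
  induction k using Nat.strong_induction_on generalizing A with
  | _ k ih =>
  have hcirc : ∀ A ⊆ V, ∀ k, 1 ≤ k → ∀ C ⊆ A, ∀ γ, IsCirc C γ → C.card = k + 1 →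
      ∃ (ι : Type) (_ : Fintype ι) (v : ι → E), Fintype.card ι = k ∧ (∀ i, v i ∈ C) ∧
      LinearIndependent ℝ v ∧
      volume (dualSlice A v) ≤ ENNReal.ofReal (simplexBound k / k.factorial) := by
    intro A hAV k hk C hCA γ hC hcard
    obtain ⟨g, hg, hmin⟩ := Finset.exists_min_image C γ hC.nonempty
    refine ⟨C.erase g, inferInstance, fun w => w, ?_, fun i => Finset.mem_of_mem_erase i.2,
      hC.linearIndependent hg,
      hC.volume_dualSlice_le hCA (hV C (hCA.trans hAV) γ hC) hk hcard hg hmin⟩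
    rw [Fintype.card_coe, Finset.card_erase_of_mem hg, hcard, Nat.add_sub_cancel]
  by_cases hex : ∃ C ⊆ A, ∃ γ, IsCirc C γ ∧ C.card = k + 1
  · obtain ⟨C, hCA, γ, hC, hcard⟩ := hex
    obtain ⟨ι, hι, v, h1, h2, h3, h4⟩ := hcirc A hAV k hk C hCA γ hC hcard
    refine ⟨ι, hι, v, h1, fun i => hCA (h2 i), h3, h4.trans (ENNReal.ofReal_le_ofReal ?_),
      fun h => absurd hcard (h C hCA γ hC)⟩
    gcongr
    exact_mod_cast simplexBound_le_sliceBound k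
  · push Not at hex
    have hfin : ∃ A' ⊆ A, PosDep ⊥ A' ∧ Module.finrank ℝ (Submodule.span ℝ (A' : Set E)) < k ∧
        ∀ B ⊆ A, PosDep ⊥ B → Module.finrank ℝ (Submodule.span ℝ (B : Set E)) < k →
        Module.finrank ℝ (Submodule.span ℝ (B : Set E)) ≤
          Module.finrank ℝ (Submodule.span ℝ (A' : Set E)) := by
      classical
      obtain ⟨A', hA', hmax⟩ := Finset.exists_max_image {B ∈ A.powerset | PosDep ⊥ B ∧
        Module.finrank ℝ (Submodule.span ℝ (B : Set E)) < k}
        (fun B => Module.finrank ℝ (Submodule.span ℝ (B : Set E)))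
        ⟨∅, Finset.mem_filter.mpr ⟨by simp, ⟨0, by simp, by simp⟩, by
          rw [Finset.coe_empty, Submodule.span_empty, finrank_bot]; exact hk⟩⟩
      simp only [Finset.mem_filter, Finset.mem_powerset] at hA' hmax
      exact ⟨A', hA'.1, hA'.2.1, hA'.2.2, fun B hB hdep hlt => hmax B ⟨hB, hdep, hlt⟩⟩
    obtain ⟨A₀, hA₀, hA₀dep, hA₀lt, hmax⟩ := hfin
    set k' := Module.finrank ℝ (Submodule.span ℝ (A₀ : Set E)) with hk'
    obtain ⟨A', hsub, hdep, hrank, hcase⟩ : ∃ A' ⊆ A, PosDep ⊥ A' ∧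
        Module.finrank ℝ (Submodule.span ℝ (A' : Set E)) = k' ∧
        ((∃ γ, IsCirc A' γ) ∨ ∀ C ⊆ A, ∀ γ, IsCirc C γ → C.card ≠ k' + 1) := by
      by_cases h : ∃ C ⊆ A, ∃ γ, IsCirc C γ ∧ C.card = k' + 1
      · obtain ⟨C, hCA, γ, hC, hcard⟩ := h
        exact ⟨C, hCA, hC.posDep, by have := hC.finrank_add_one; omega, Or.inl ⟨γ, hC⟩⟩
      · push Not at h
        exact ⟨A₀, hA₀, hA₀dep, rfl, Or.inr h⟩
    obtain ⟨W, C, γ, hCA, hWC, hC, hWcard, hli⟩ := exists_circuit_extension hA hdep hsub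
      (by omega) (fun B hB h1 h2 => by rw [hrank]; exact hmax B hB h1 (by omega))
    rw [hrank, hAk] at hWcard
    have hCle := Finset.card_le_card hWC
    obtain ⟨s, hs⟩ : ∃ s, C.card = s + 1 := ⟨C.card - 1, by omega⟩
    have hsrank := hC.finrank_add_one
    have hsk : s ≤ k := by
      have := FiniteDimensional.span_of_finite ℝ A.finite_toSet
      have := Submodule.finrank_mono (R := ℝ) (Submodule.span_mono (R := ℝ)
        (show (C : Set E) ⊆ A by exact_mod_cast hCA))
      omega
    have hsne : s ≠ k := fun h => hex C hCA γ hC (by omega)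
    have hsk' : s ≤ k' := by
      have := hmax C hCA hC.posDep (by omega)
      omega
    have hs1 : 1 ≤ s := by omega
    obtain ⟨B, hB, ι, hι, v, hcardι, hvA, hvli, hvol⟩ : ∃ B : ℕ,
        (B = simplexBound k' ∨ (B = sliceBound k' ∧ s < k')) ∧
        ∃ (ι : Type) (_ : Fintype ι) (v : ι → E), Fintype.card ι = k' ∧ (∀ i, v i ∈ A') ∧
        LinearIndependent ℝ v ∧
        volume (dualSlice A' v) ≤ ENNReal.ofReal (B / k'.factorial) := by
      rcases hcase with ⟨γ', hγ'⟩ | hno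
      · exact ⟨_, Or.inl rfl, hcirc A' (hsub.trans hAV) k' (by omega) A' subset_rfl γ' hγ'
          (by have := hγ'.finrank_add_one; omega)⟩
      · have hlt : s < k' := hsk'.lt_of_ne fun h => hno C hCA γ hC (by omega)
        obtain ⟨ι, hι, v, h1, h2, h3, h4, -⟩ :=
          ih k' hA₀lt (by omega) A' (hsub.trans hAV) hdep hrank
        exact ⟨_, Or.inr ⟨rfl, hlt⟩, ι, hι, v, h1, h2, h3, h4⟩
    obtain ⟨b, hb, hmin⟩ := Finset.exists_min_image W γ (Finset.card_pos.mp (by omega))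
    have hbound := volume_dualSlice_sum_le hC (hV C (hCA.trans hAV) γ hC) hsub hCA hWC hs1 hsk'
      hA₀lt hs hWcard hB hvol hb hmin
    refine ⟨ι ⊕ W.erase b, inferInstance, Sum.elim v fun w => (w : E), ?_, ?_, ?_, ?_,
      fun _ => hbound⟩
    · rw [Fintype.card_sum, hcardι, Fintype.card_coe, Finset.card_erase_of_mem hb]
      omega
    · rintro (i | i)
      · exact hsub (hvA i)
      · exact hCA (hWC (Finset.mem_of_mem_erase i.2))
    · refine LinearIndependent.sumElim_of_quotient
        (f := fun i => (⟨v i, Submodule.subset_span (hvA i)⟩ :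
          Submodule.span ℝ (A' : Set E))) ?_ _ (hli b hb)
      exact LinearIndependent.of_comp (Submodule.subtype _) hvli
    · refine hbound.trans (ENNReal.ofReal_le_ofReal ?_)
      gcongr
      linarith

end

/-- The length of the `j`-th axis edge of the simplex `Ssimplex d`. -/
noncomputable def axisLength (d j : ℕ) : ℝ :=
  if j = d - 1 then 2 * ((sylvester (d - 1) : ℝ) - 1) else (sylvester j : ℝ)

lemma axisLength_last (d : ℕ) : axisLength d (d - 1) = 2 * sylvPred (d - 1) := by
  simp [axisLength, sylvester_eq]

lemma axisLength_of_lt {d j : ℕ} (hj : j < d - 1) : axisLength d j = sylvPred j + 1 := by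
  rw [axisLength, if_neg hj.ne, sylvester_eq]
  push_cast
  rfl

lemma axisLength_pos (d j : ℕ) : 0 < axisLength d j := by
  have h1 := sylvPred_pos_real (d - 1)
  rw [axisLength, sylvester_eq, sylvester_eq]
  push_cast
  split_ifs <;> [linarith; positivity]

lemma prod_axisLength {d : ℕ} (hd : 1 ≤ d) :
    ∏ j : Fin d, axisLength d j = 2 * (sylvPred (d - 1) : ℝ) ^ 2 := by
  obtain ⟨n, rfl⟩ : ∃ n, d = n + 1 := ⟨d - 1, by omega⟩
  rw [Fin.prod_univ_eq_prod_range (axisLength (n + 1)), Finset.prod_range_succ,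
    Finset.prod_congr rfl fun j hj => axisLength_of_lt (d := n + 1) (by simpa using hj)]
  have h1 := prod_sylv_inv n
  have h2 := axisLength_last (n + 1)
  simp only [Nat.add_sub_cancel] at h2 ⊢
  rw [h2]
  simp only [one_div, Finset.prod_inv_distrib, inv_inj] at h1
  rw [h1]
  ring

lemma sum_inv_axisLength {d : ℕ} (hd : 1 ≤ d) :
    ∑ j : Fin d, 1 / axisLength d j = 1 - 1 / (2 * sylvPred (d - 1)) := by
  obtain ⟨n, rfl⟩ : ∃ n, d = n + 1 := ⟨d - 1, by omega⟩
  rw [Fin.sum_univ_eq_sum_range (fun j => 1 / axisLength (n + 1) j), Finset.sum_range_succ,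
    Finset.sum_congr rfl fun j hj => by
      rw [axisLength_of_lt (d := n + 1) (by simpa using hj)]]
  have h1 := sum_sylv_inv (Nat.zero_le n)
  have h2 := axisLength_last (n + 1)
  have h3 := sylvPred_pos_real n
  simp only [Nat.add_sub_cancel] at h2 ⊢
  rw [h2, Finset.range_eq_Ico, h1, show sylvPred 0 = 1 from rfl]
  push_cast
  field_simp
  ring

lemma mem_polarDual_convexHull {d : ℕ} {V : Set (Fin d → ℝ)} {y : Fin d → ℝ} :
    y ∈ polarDual (convexHull ℝ V) ↔ ∀ v ∈ V, -1 ≤ ∑ i, y i * v i := by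
  refine ⟨fun h v hv => h v (subset_convexHull ℝ V hv), fun h => ?_⟩
  have hconv : Convex ℝ {x : Fin d → ℝ | -1 ≤ ∑ i, y i * x i} := by
    refine convex_halfSpace_ge (IsLinearMap.mk (fun a b => ?_) fun c a => ?_) (-1)
    · simp [mul_add, Finset.sum_add_distrib]
    · simp only [Pi.smul_apply, smul_eq_mul, Finset.mul_sum]
      exact Finset.sum_congr rfl fun i _ => by ring
  exact fun x hx => convexHull_min h hconv hx

lemma mem_polarDual_Rsimplex {d : ℕ} {y : Fin d → ℝ} :
    y ∈ polarDual (Rsimplex d) ↔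
      ∑ i, y i ≤ 1 ∧ ∀ j : Fin d, -1 ≤ axisLength d j * y j - ∑ i, y i := by
  rw [Rsimplex, Ssimplex, show (fun x : Fin d → ℝ => x - fun _ => 1) =
    (AffineEquiv.vaddConst ℝ (-fun _ : Fin d => (1 : ℝ))).toAffineMap by
      ext x; simp [sub_eq_add_neg], AffineMap.image_convexHull, mem_polarDual_convexHull]
  have h0 : ∑ i, y i * ((0 : Fin d → ℝ) i - 1) = -∑ i, y i := by simp
  have hj : ∀ j : Fin d, ∑ i, y i * ((axisLength d j • Pi.single j (1 : ℝ) : Fin d → ℝ) i - 1) =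
      axisLength d j * y j - ∑ i, y i := by
    intro j
    simp [mul_sub, Finset.sum_sub_distrib, Pi.single_apply, mul_comm]
  constructor
  · intro h
    constructor
    · have := h _ (mem_image_of_mem _ (Or.inl rfl : (0 : Fin d → ℝ) ∈ _))
      simp at this
      linarith
    · intro j
      have := h _ (mem_image_of_mem _ (Or.inr ⟨j, rfl⟩))
      rw [← hj j]
      convert this using 2
      unfold axisLength
      split_ifs <;> simp [sub_eq_add_neg]
  · rintro ⟨h1, h2⟩ _ ⟨x, hx | ⟨j, rfl⟩, rfl⟩
    · rw [Set.mem_singleton_iff.mp hx]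
      simp
      linarith
    · have := h2 j
      rw [← hj j] at this
      convert this using 2
      unfold axisLength
      split_ifs <;> simp [sub_eq_add_neg]

/-- The vertex of the dual of `Rsimplex d` that is not a standard basis vector. -/
noncomputable def dualApex (d : ℕ) : Fin d → ℝ :=
  fun j => -(2 * sylvPred (d - 1) / axisLength d j)

lemma sum_dualApex {d : ℕ} (hd : 1 ≤ d) : ∑ j, dualApex d j = 1 - 2 * sylvPred (d - 1) := by
  have h1 := sum_inv_axisLength hd
  have h2 := sylvPred_pos_real (d - 1)
  simp_rw [dualApex, Finset.sum_neg_distrib, div_eq_mul_one_div (2 * (sylvPred (d - 1) : ℝ)),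
    ← Finset.mul_sum, h1]
  field_simp
  ring

lemma polarDual_Rsimplex {d : ℕ} (hd : 1 ≤ d) : polarDual (Rsimplex d) =
    convexHull ℝ (insert (dualApex d) (Set.range fun j : Fin d => Pi.single j (1 : ℝ))) := by
  have hx := sylvPred_pos_real (d - 1)
  have hx1 : (1 : ℝ) ≤ sylvPred (d - 1) := by exact_mod_cast sylvPred_pos (d - 1)
  apply Subset.antisymm
  · intro y hy
    rw [mem_polarDual_Rsimplex] at hy
    obtain ⟨h1, h2⟩ := hy
    set s := ∑ i, y i
    set f : Option (Fin d) → Fin d → ℝ := fun o => o.elim (dualApex d) fun j => Pi.single j 1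
    set w : Option (Fin d) → ℝ :=
      fun o => o.elim ((1 - s) / (2 * sylvPred (d - 1))) fun j => y j + (1 - s) / axisLength d j
    have hw : ∀ o ∈ Finset.univ, 0 ≤ w o := by
      rintro (_ | j) -
      · exact div_nonneg (by linarith) (by positivity)
      · have h3 := h2 j
        have h4 := axisLength_pos d j
        change 0 ≤ y j + (1 - s) / axisLength d j
        have h5 : y j + (1 - s) / axisLength d j =
            (axisLength d j * y j - s + 1) / axisLength d j := by
          field_simp
          ring
        rw [h5]
        exact div_nonneg (by linarith) h4.le
    have hs : ∑ o, w o = 1 := by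
      rw [Fintype.sum_option]
      change (1 - s) / (2 * sylvPred (d - 1)) + ∑ j, (y j + (1 - s) / axisLength d j) = 1
      simp_rw [Finset.sum_add_distrib, div_eq_mul_one_div (1 - s), ← Finset.mul_sum,
        sum_inv_axisLength hd]
      ring
    have hsum : ∑ o, w o • f o = y := by
      ext i
      rw [Finset.sum_apply, Fintype.sum_option]
      change (1 - s) / (2 * sylvPred (d - 1)) * -(2 * sylvPred (d - 1) / axisLength d i) +
        ∑ j : Fin d, (y j + (1 - s) / axisLength d j) * (Pi.single j (1 : ℝ) : Fin d → ℝ) i = y i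
      have h4 := axisLength_pos d i
      simp only [Pi.single_apply, mul_ite, mul_one, mul_zero, Finset.sum_ite_eq, Finset.mem_univ,
        if_true]
      field_simp
      ring
    rw [← hsum]
    refine (convex_convexHull ℝ _).sum_mem hw hs fun o _ => subset_convexHull ℝ _ ?_
    rcases o with _ | j
    · exact Set.mem_insert _ _
    · exact Set.mem_insert_of_mem _ ⟨j, rfl⟩
  · have hconv : Convex ℝ (polarDual (Rsimplex d)) := by
      intro y hy z hz a b ha hb hab x hx
      have h1 := hy x hx
      have h2 := hz x hx
      have h3 : ∑ i, (a • y + b • z) i * x i = a * ∑ i, y i * x i + b * ∑ i, z i * x i := by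
        rw [Finset.mul_sum, Finset.mul_sum, ← Finset.sum_add_distrib]
        refine Finset.sum_congr rfl fun i _ => ?_
        simp only [Pi.add_apply, Pi.smul_apply, smul_eq_mul]
        ring
      rw [h3]
      nlinarith
    refine convexHull_min ?_ hconv
    intro y hy
    rw [mem_polarDual_Rsimplex]
    rcases hy with rfl | ⟨j, rfl⟩
    · rw [sum_dualApex hd]
      refine ⟨by linarith, fun j => ?_⟩
      have h4 := axisLength_pos d j
      have : axisLength d j * dualApex d j = -(2 * sylvPred (d - 1)) := by
        rw [dualApex]
        field_simp
      rw [this]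
      linarith
    · simp only [Finset.sum_pi_single', Finset.mem_univ, if_true]
      refine ⟨le_rfl, fun i => ?_⟩
      have h4 := axisLength_pos d i
      have : (0 : ℝ) ≤ (Pi.single j (1 : ℝ) : Fin d → ℝ) i := by
        rw [Pi.single_apply]; split_ifs <;> norm_num
      nlinarith

lemma zero_mem_interior_polarDual_Rsimplex (d : ℕ) : 0 ∈ interior (polarDual (Rsimplex d)) := by
  rw [mem_interior]
  refine ⟨{y | ∑ i, y i < 1} ∩ ⋂ j : Fin d, {y | -1 < axisLength d j * y j - ∑ i, y i}, ?_, ?_, ?_⟩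
  · rintro y ⟨h1, h2⟩
    rw [mem_polarDual_Rsimplex]
    exact ⟨le_of_lt h1, fun j => le_of_lt (Set.mem_iInter.mp h2 j)⟩
  · refine (isOpen_lt (by fun_prop) (by fun_prop)).inter (isOpen_iInter_of_finite fun j => ?_)
    exact isOpen_lt (by fun_prop) (by fun_prop)
  · simp

lemma volume_polarDual_polarDual_Rsimplex {d : ℕ} (hd : 1 ≤ d) :
    volume (polarDual (polarDual (Rsimplex d))) =
      ENNReal.ofReal (2 * (sylvPred (d - 1) : ℝ) ^ 2 / d.factorial) := by
  have hpos : ∀ i : Fin d, 0 < 1 / axisLength d i := fun i => one_div_pos.mpr (axisLength_pos d i)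
  have hx := sylvPred_pos_real (d - 1)
  have h : polarDual (polarDual (Rsimplex d)) = {u : Fin d → ℝ | (∀ i, -1 ≤ u i) ∧
      ∑ i : Fin d, 1 / axisLength d i * (u i + 1) ≤ 1} := by
    ext u
    rw [polarDual_Rsimplex hd, mem_polarDual_convexHull]
    simp only [Set.forall_mem_insert, Set.forall_mem_range, Set.mem_ofPred_eq]
    rw [and_comm]
    have h1 : ∑ i, u i * dualApex d i =
        -(2 * sylvPred (d - 1) * ∑ i : Fin d, 1 / axisLength d i * u i) := by
      rw [Finset.mul_sum, ← Finset.sum_neg_distrib]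
      refine Finset.sum_congr rfl fun i _ => ?_
      rw [dualApex]
      ring
    have h2 : ∑ i : Fin d, 1 / axisLength d i * (u i + 1) =
        ∑ i : Fin d, 1 / axisLength d i * u i + (1 - 1 / (2 * sylvPred (d - 1))) := by
      rw [← sum_inv_axisLength hd, ← Finset.sum_add_distrib]
      exact Finset.sum_congr rfl fun i _ => by ring
    have h3 : (-1 ≤ ∑ i, u i * dualApex d i) ↔
        ∑ i : Fin d, 1 / axisLength d i * (u i + 1) ≤ 1 := by
      rw [h1, h2]
      have : ∑ i : Fin d, 1 / axisLength d i * u i + (1 - 1 / (2 * sylvPred (d - 1))) ≤ 1 ↔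
          ∑ i : Fin d, 1 / axisLength d i * u i ≤ 1 / (2 * sylvPred (d - 1)) := by
        constructor <;> intro h <;> linarith
      rw [this, le_div_iff₀ (by positivity)]
      constructor <;> intro h <;> linarith
    rw [h3]
    refine and_congr_left fun _ => forall_congr' fun j => ?_
    simp [Pi.single_apply]
  rw [h, volume_weighted_simplex hpos]
  congr 1
  rw [Fintype.card_fin]
  simp only [one_div, Finset.prod_inv_distrib]
  rw [prod_axisLength hd]
  have hf : (0 : ℝ) < d.factorial := by exact_mod_cast Nat.factorial_pos _
  field_simp

/-- The linear functional `x ↦ ⟨y, x⟩`. -/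
noncomputable def pairing {d : ℕ} (y : Fin d → ℝ) : (Fin d → ℝ) →ₗ[ℝ] ℝ :=
  ∑ i, y i • LinearMap.proj i

lemma pairing_apply {d : ℕ} (y x : Fin d → ℝ) : pairing y x = ∑ i, y i * x i := by
  simp [pairing]

lemma eq_pairing {d : ℕ} (f : (Fin d → ℝ) →ₗ[ℝ] ℝ) :
    f = pairing fun i => f (Pi.single i 1) := by
  ext i
  simp [pairing_apply, Pi.single_apply]

lemma posDep_of_zero_mem_interior {d : ℕ} {V : Finset (Fin d → ℝ)}
    (h0 : 0 ∈ interior (convexHull ℝ (V : Set (Fin d → ℝ)))) : PosDep ⊥ V := by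
  have hc : Filter.Tendsto (fun e : ℝ => -(e • ∑ v ∈ V, v)) (nhdsWithin 0 (Set.Ioi 0))
      (nhds 0) := by
    have : Continuous fun e : ℝ => -(e • ∑ v ∈ V, v) := by fun_prop
    simpa using (this.tendsto 0).mono_left nhdsWithin_le_nhds
  obtain ⟨e, he, he0⟩ := ((hc.eventually (mem_interior_iff_mem_nhds.mp h0)).and
    self_mem_nhdsWithin).exists
  obtain ⟨w, hw, -, hws⟩ := Finset.mem_convexHull'.mp he
  refine ⟨fun v => w v + e, fun v hv => by have := hw v hv; positivity, ?_⟩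
  simp only [add_smul, Finset.sum_add_distrib, hws, Finset.smul_sum]
  simp

lemma finrank_span_of_zero_mem_interior {d : ℕ} {V : Finset (Fin d → ℝ)}
    (h0 : 0 ∈ interior (convexHull ℝ (V : Set (Fin d → ℝ)))) :
    Module.finrank ℝ (Submodule.span ℝ (V : Set (Fin d → ℝ))) = d := by
  have h : Submodule.span ℝ (V : Set (Fin d → ℝ)) = ⊤ := by
    apply Submodule.eq_top_of_nonempty_interior'
    refine ⟨0, interior_mono ?_ h0⟩
    exact convexHull_min Submodule.subset_span (Submodule.convex _)
  rw [h, finrank_top, Module.finrank_fin_fun]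

lemma exists_int_matrix {d : ℕ} {v : Fin d → Fin d → ℝ} (hlat : ∀ i, IsLatticePt (v i))
    (hv : LinearIndependent ℝ v) :
    ∃ N : Matrix (Fin d) (Fin d) ℤ, N.det ≠ 0 ∧ ∀ i j, v i j = N i j := by
  choose N hN using hlat
  refine ⟨Matrix.of N, fun h => ?_, hN⟩
  have h1 : ((Matrix.of N).map (Int.castRingHom ℝ)).row = v := by
    ext i j
    simp [hN i j]
  rw [← h1, Matrix.linearIndependent_rows_iff_isUnit, Matrix.isUnit_iff_isUnit_det] at hv
  refine hv.ne_zero ?_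
  rw [← RingHom.mapMatrix_apply, ← RingHom.map_det, h, map_zero]

lemma volume_le_of_matrix {d : ℕ} {N : Matrix (Fin d) (Fin d) ℤ} (hN : N.det ≠ 0)
    {v : Fin d → Fin d → ℝ} (hv : ∀ i j, v i j = N i j) {S Q : Set (Fin d → ℝ)}
    (h : ∀ y ∈ Q, (fun i => pairing y (v i)) ∈ S) :
    volume Q ≤ ENNReal.ofReal |(N.det : ℝ)|⁻¹ * volume S := by
  have hdet : LinearMap.det (Matrix.toLin' (N.map (Int.castRingHom ℝ))) = (N.det : ℝ) := by
    rw [LinearMap.det_toLin', ← RingHom.mapMatrix_apply, ← RingHom.map_det, eq_intCast]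
  have h1 := Measure.addHaar_preimage_linearMap (volume : Measure (Fin d → ℝ))
    (f := Matrix.toLin' (N.map (Int.castRingHom ℝ))) (by rw [hdet]; exact_mod_cast hN) S
  rw [hdet, abs_inv] at h1
  rw [← h1]
  refine measure_mono fun y hy => ?_
  change Matrix.toLin' (N.map (Int.castRingHom ℝ)) y ∈ S
  convert h y hy using 1
  ext i
  rw [Matrix.toLin'_apply, pairing_apply]
  simp [Matrix.mulVec, dotProduct, hv, mul_comm]

lemma inv_abs_det_le_one {d : ℕ} {N : Matrix (Fin d) (Fin d) ℤ} (hN : N.det ≠ 0) :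
    |(N.det : ℝ)|⁻¹ ≤ 1 := by
  apply inv_le_one_of_one_le₀
  exact_mod_cast Int.one_le_abs hN

lemma volume_polarDual_le_dualSlice {d : ℕ} {V : Finset (Fin d → ℝ)}
    (hlat : ∀ v ∈ V, IsLatticePt v) {ι : Type} [Fintype ι] {v : ι → Fin d → ℝ}
    (hcard : Fintype.card ι = d) (hvV : ∀ i, v i ∈ V) (hv : LinearIndependent ℝ v) :
    volume (polarDual (convexHull ℝ (V : Set (Fin d → ℝ)))) ≤ volume (dualSlice V v) := by
  have e : Fin d ≃ ι := (Fintype.equivFinOfCardEq hcard).symm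
  obtain ⟨N, hN, hvN⟩ := exists_int_matrix (v := v ∘ e) (fun i => hlat _ (hvV _))
    (hv.comp e e.injective)
  have h1 := volume_le_of_matrix hN hvN (S := (MeasurableEquiv.piCongrLeft (fun _ : ι => ℝ) e) ⁻¹'
    dualSlice V v) (Q := polarDual (convexHull ℝ (V : Set (Fin d → ℝ)))) (by
      intro y hy
      rw [mem_polarDual_convexHull] at hy
      refine ⟨pairing y, fun i => ?_, fun w hw => ?_⟩
      · obtain ⟨j, rfl⟩ := e.surjective i
        rw [MeasurableEquiv.coe_piCongrLeft, Equiv.piCongrLeft_apply_apply]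
        rfl
      · rw [pairing_apply]
        exact hy w hw)
  rw [(volume_measurePreserving_piCongrLeft (fun _ : ι => ℝ) e).measure_preimage_equiv] at h1
  refine h1.trans (mul_le_of_le_one_left' ?_)
  rw [ENNReal.ofReal_le_one]
  exact inv_abs_det_le_one hN

/-- If the dual volume is maximal, then there is a full-dimensional circuit among the vertices. -/
lemma exists_circ_of_le_volume {d : ℕ} (hd : 4 ≤ d) {V : Finset (Fin d → ℝ)}
    (hlat : ∀ v ∈ V, IsLatticePt v) (hP : IsCanonicalFano (convexHull ℝ (V : Set (Fin d → ℝ))))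
    (hvol : ENNReal.ofReal (2 * (sylvPred (d - 1) : ℝ) ^ 2 / d.factorial) ≤
      volume (polarDual (convexHull ℝ (V : Set (Fin d → ℝ))))) :
    ∃ C ⊆ V, ∃ γ, IsCirc C γ ∧ ProdLeSum C γ ∧ C.card = d + 1 := by
  have hV : ∀ C ⊆ V, ∀ γ, IsCirc C γ → ProdLeSum C γ := fun C hCV γ hC J K hJK hCJK hK =>
    hC.prod_le hP (fun v hv => subset_convexHull ℝ _ (hCV hv)) (fun v hv => hlat v (hCV hv))
      hJK hCJK hK
  obtain ⟨ι, _, v, hcard, hvV, hv, -, h⟩ := exists_volume_dualSlice_le hV d (by omega) V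
    subset_rfl (posDep_of_zero_mem_interior hP.zero_mem_interior)
    (finrank_span_of_zero_mem_interior hP.zero_mem_interior)
  by_contra! hcon
  have h1 := (hvol.trans (volume_polarDual_le_dualSlice hlat hcard hvV hv)).trans
    (h fun C hCV γ hC => hcon C hCV γ hC (hV C hCV γ hC))
  have hx : (1 : ℝ) ≤ sylvPred (d - 1) := by exact_mod_cast sylvPred_pos (d - 1)
  have hf : (0 : ℝ) < d.factorial := by exact_mod_cast Nat.factorial_pos _
  rw [sliceBound_of_four_le hd] at h1
  push_cast at h1
  rw [ENNReal.ofReal_le_ofReal_iff (div_nonneg (by nlinarith) hf.le),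
    div_le_div_iff_of_pos_right hf] at h1
  linarith

lemma volume_polarDual_circ {d : ℕ} (hd : 4 ≤ d) {C : Finset (Fin d → ℝ)} {γ : (Fin d → ℝ) → ℝ}
    (hC : IsCirc C γ) (hCP : ProdLeSum C γ) (hcard : C.card = d + 1)
    (hlat : ∀ v ∈ C, IsLatticePt v) :
    volume (polarDual (convexHull ℝ (C : Set (Fin d → ℝ)))) ≤
      ENNReal.ofReal (2 * (sylvPred (d - 1) : ℝ) ^ 2 / d.factorial) ∧
    (ENNReal.ofReal (2 * (sylvPred (d - 1) : ℝ) ^ 2 / d.factorial) ≤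
      volume (polarDual (convexHull ℝ (C : Set (Fin d → ℝ)))) →
      ∃ N : Matrix (Fin d) (Fin d) ℤ, IsUnit N.det ∧ (C : Set (Fin d → ℝ)) =
        (Matrix.toLin' (N.map (Int.castRingHom ℝ))) ''
          insert (dualApex d) (Set.range fun j : Fin d => Pi.single j (1 : ℝ))) := by
  obtain ⟨g, hg, hmin⟩ := Finset.exists_min_image C γ hC.nonempty
  obtain ⟨c, hinj, him, hw, -⟩ := hCP.exists_enumeration hC.pos hC.sum hcard hg hmin
  have hmem : ∀ i < d + 1, c i ∈ C := fun i hi => by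
    rw [← him]; exact Finset.mem_image_of_mem _ (Finset.mem_range.mpr hi)
  have hinj' : Set.InjOn c (Finset.range d) := hinj.mono (by simp)
  have hlin : LinearIndependent ℝ fun i : Fin d => c i := by
    refine (hC.linearIndependent (hmem d d.lt_succ_self)).comp (fun i : Fin d =>
      ⟨c i, Finset.mem_erase.mpr ⟨fun h => ?_, hmem i (by omega)⟩⟩) fun i j h => ?_
    · have := hinj (by simp) (by simp) h
      omega
    · exact Fin.ext (hinj (by simp) (by simp) (Subtype.ext_iff.mp h))
  obtain ⟨N, hN, hcN⟩ := exists_int_matrix (fun i => hlat _ (hmem i (by omega))) hlin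
  have hpos : ∀ i : Fin d, 0 < γ (c i) := fun i => hC.pos _ (hmem i (by omega))
  have hvol := volume_le_of_matrix hN hcN (S := {u : Fin d → ℝ | (∀ i, -1 ≤ u i) ∧
    ∑ i : Fin d, γ (c i) * (u i + 1) ≤ 1})
    (Q := polarDual (convexHull ℝ (C : Set (Fin d → ℝ)))) (by
      intro y hy
      rw [mem_polarDual_convexHull] at hy
      have hy' : ∀ w ∈ C, -1 ≤ pairing y w := fun w hw => by rw [pairing_apply]; exact hy w hw
      refine ⟨fun i => hy' _ (hmem i (by omega)), ?_⟩
      have h1 := hC.sum_erase_le (W := (Finset.range d).image c) (by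
        intro w hw
        obtain ⟨i, hi, rfl⟩ := Finset.mem_image.mp hw
        exact hmem i (by have := Finset.mem_range.mp hi; omega)) hy'
      rw [Finset.sum_image hinj'] at h1
      rwa [Fin.sum_univ_eq_sum_range (fun i => γ (c i) * (pairing y (c i) + 1))])
  have hf : (0 : ℝ) < d.factorial := by exact_mod_cast Nat.factorial_pos _
  have hx := sylvPred_pos_real (d - 1)
  have hprod := hw.prod_ge (by omega)
  have hsb : (simplexBound d : ℝ) = 2 * (sylvPred (d - 1) : ℝ) ^ 2 := by
    rw [simplexBound, if_neg (by omega)]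
    push_cast
    rfl
  set p := ∏ i ∈ Finset.range d, γ (c i) with hp
  rw [volume_weighted_simplex hpos, Fintype.card_fin,
    Fin.prod_univ_eq_prod_range (fun i => γ (c i)), ← hp,
    ← ENNReal.ofReal_mul (by positivity)] at hvol
  have hp0 : 0 < p := lt_of_lt_of_le (by rw [hsb]; positivity) hprod
  have hD : (1 : ℝ) ≤ |(N.det : ℝ)| := by exact_mod_cast Int.one_le_abs hN
  have hpx : 1 ≤ 2 * (sylvPred (d - 1) : ℝ) ^ 2 * p := by
    rw [hsb, div_le_iff₀ (by positivity)] at hprod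
    linarith
  constructor
  · refine hvol.trans (ENNReal.ofReal_le_ofReal ?_)
    refine (mul_le_of_le_one_left (by positivity) (inv_abs_det_le_one hN)).trans ?_
    rw [div_le_div_iff₀ (by positivity) hf]
    nlinarith
  · intro hle
    have h1 := hle.trans hvol
    rw [ENNReal.ofReal_le_ofReal_iff (by positivity), inv_mul_eq_div, div_div,
      div_le_div_iff₀ hf (by positivity)] at h1
    have h2 : 2 * (sylvPred (d - 1) : ℝ) ^ 2 * p * |(N.det : ℝ)| ≤ 1 := by
      have : d.factorial * (2 * (sylvPred (d - 1) : ℝ) ^ 2 * p * |(N.det : ℝ)|) ≤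
        d.factorial * 1 := by linarith
      exact le_of_mul_le_mul_left this hf
    have hD1 : |(N.det : ℝ)| = 1 := le_antisymm (by nlinarith) hD
    have hp1 : p ≤ 1 / (simplexBound d : ℝ) := by
      rw [hsb, le_div_iff₀ (by positivity)]
      rw [hD1] at h2
      linarith
    obtain ⟨hb1, hb2, hb3⟩ := hw.eq_of_prod_le hd hp1
    have hb : ∀ i < d, γ (c i) = 1 / axisLength d i := by
      intro i hi
      rcases Nat.lt_or_ge i (d - 1) with h | h
      · rw [axisLength_of_lt h]
        exact hb1 i h
      · obtain rfl : i = d - 1 := by omega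
        rw [axisLength_last]
        exact hb2
    have hapex : c d = ∑ i : Fin d, dualApex d i • c i := by
      have h3 := hC.zero
      rw [← him, Finset.sum_image hinj, Finset.sum_range_succ] at h3
      rw [show γ (c d) = _ from hb3, add_comm, add_eq_zero_iff_eq_neg] at h3
      have h4 : c d = (2 * (sylvPred (d - 1) : ℝ)) • (1 / (2 * (sylvPred (d - 1) : ℝ))) • c d := by
        rw [smul_smul, mul_one_div_cancel (by positivity), one_smul]
      rw [h4, h3, ← Fin.sum_univ_eq_sum_range (fun i => γ (c i) • c i), ← Finset.sum_neg_distrib,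
        Finset.smul_sum]
      refine Finset.sum_congr rfl fun i _ => ?_
      rw [hb i i.2, dualApex, ← neg_smul, smul_smul]
      congr 1
      ring
    have hT : ∀ u : Fin d → ℝ, Matrix.toLin' (N.transpose.map (Int.castRingHom ℝ)) u =
        ∑ i : Fin d, u i • c i := by
      intro u
      ext j
      rw [Matrix.toLin'_apply, Finset.sum_apply]
      simp [Matrix.mulVec, dotProduct, hcN, mul_comm]
    refine ⟨N.transpose, ?_, ?_⟩
    · rw [Matrix.det_transpose, Int.isUnit_iff_abs_eq]
      exact_mod_cast hD1
    · rw [Set.image_insert_eq, hT, ← hapex, ← Set.range_comp, ← him, Finset.range_add_one,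
        Finset.image_insert, Finset.coe_insert]
      congr 1
      ext w
      simp only [Finset.coe_image, Finset.coe_range, Set.mem_image, Set.mem_Iio, Set.mem_range,
        Function.comp_apply, hT, Pi.single_apply, ite_smul, one_smul, zero_smul,
        Finset.sum_ite_eq', Finset.mem_univ, if_true]
      exact ⟨fun ⟨i, hi, h⟩ => ⟨⟨i, hi⟩, h⟩, fun ⟨i, h⟩ => ⟨i, i.2, h⟩⟩

lemma subset_convexHull_of_volume_le {d : ℕ} {C V : Finset (Fin d → ℝ)} (hCV : C ⊆ V)
    (h0 : 0 ∈ convexHull ℝ (C : Set (Fin d → ℝ)))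
    (hvol : volume (polarDual (convexHull ℝ (C : Set (Fin d → ℝ)))) ≤
      volume (polarDual (convexHull ℝ (V : Set (Fin d → ℝ)))))
    (hfin : volume (polarDual (convexHull ℝ (V : Set (Fin d → ℝ)))) ≠ ⊤) :
    (V : Set (Fin d → ℝ)) ⊆ convexHull ℝ (C : Set (Fin d → ℝ)) := by
  intro v hv
  by_contra hvC
  obtain ⟨f, u, hfv, hfC⟩ := geometric_hahn_banach_point_closed
    (convex_convexHull ℝ (C : Set (Fin d → ℝ)))
    (C.finite_toSet.isCompact_convexHull ℝ).isClosed hvC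
  have hu : u < 0 := by simpa using hfC 0 h0
  set U : Set (Fin d → ℝ) := {y | ∑ i, y i * v i < -1} ∩ ⋂ c ∈ C, {y | -1 < ∑ i, y i * c i}
    with hU
  have hUo : IsOpen U := by
    refine (isOpen_lt (by fun_prop) (by fun_prop)).inter
      (isOpen_biInter_finset fun c _ => isOpen_lt (by fun_prop) (by fun_prop))
  have hUne : U.Nonempty := by
    have h1 := eq_pairing ((-u)⁻¹ • (f : (Fin d → ℝ) →ₗ[ℝ] ℝ))
    set y := fun i => ((-u)⁻¹ • (f : (Fin d → ℝ) →ₗ[ℝ] ℝ)) (Pi.single i 1)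
    have h2 : ∀ w, ∑ i, y i * w i = (-u)⁻¹ * f w := fun w => by
      rw [← pairing_apply, ← h1]
      rfl
    refine ⟨y, ?_, Set.mem_iInter₂.mpr fun c hc => ?_⟩
    · change ∑ i, y i * v i < -1
      rw [h2, inv_mul_eq_div, div_lt_iff₀ (by linarith)]
      linarith
    · change -1 < ∑ i, y i * c i
      have := hfC c (subset_convexHull ℝ _ hc)
      rw [h2, inv_mul_eq_div, lt_div_iff₀ (by linarith)]
      linarith
  have hdisj : Disjoint (polarDual (convexHull ℝ (V : Set (Fin d → ℝ)))) U := by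
    rw [Set.disjoint_left]
    intro y hy hyU
    exact absurd (mem_polarDual_convexHull.mp hy v hv) (not_le.mpr hyU.1)
  have hsub : polarDual (convexHull ℝ (V : Set (Fin d → ℝ))) ∪ U ⊆
      polarDual (convexHull ℝ (C : Set (Fin d → ℝ))) := by
    intro y hy
    rw [mem_polarDual_convexHull]
    intro c hc
    rcases hy with hy | hy
    · exact mem_polarDual_convexHull.mp hy c (hCV hc)
    · exact le_of_lt (Set.mem_iInter₂.mp hy.2 c hc)
  have h3 := (measure_mono hsub).trans hvol
  rw [measure_union hdisj hUo.measurableSet] at h3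
  have h4 := (hUo.measure_pos volume hUne).ne'
  exact (ENNReal.lt_add_right hfin h4).not_ge h3

lemma toLin'_nonsing_inv_apply {d : ℕ} {A : Matrix (Fin d) (Fin d) ℤ} (hA : IsUnit A.det)
    (u : Fin d → ℝ) : Matrix.toLin' (A.map (Int.castRingHom ℝ))
      (Matrix.toLin' (A⁻¹.map (Int.castRingHom ℝ)) u) = u := by
  rw [← LinearMap.comp_apply, ← Matrix.toLin'_mul, ← Matrix.map_mul, Matrix.mul_nonsing_inv A hA]
  simp

lemma unimodularEquiv_iff {d : ℕ} {P Q : Set (Fin d → ℝ)} : UnimodularEquiv P Q ↔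
    ∃ (A : Matrix (Fin d) (Fin d) ℤ) (b : Fin d → ℤ), IsUnit A.det ∧
      Q = (fun x => Matrix.toLin' (A.map (Int.castRingHom ℝ)) x + fun i => (b i : ℝ)) '' P :=
  Iff.rfl

lemma unimodularEquiv_of_image {d : ℕ} {Q : Set (Fin d → ℝ)} {A : Matrix (Fin d) (Fin d) ℤ}
    (hA : IsUnit A.det) :
    UnimodularEquiv (Matrix.toLin' (A.map (Int.castRingHom ℝ)) '' Q) Q := by
  have hA' : IsUnit (A⁻¹).det := A.isUnit_nonsing_inv_det hA
  refine unimodularEquiv_iff.mpr ⟨A⁻¹, 0, hA', ?_⟩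
  rw [Set.image_image]
  have h := toLin'_nonsing_inv_apply hA'
  rw [Matrix.nonsing_inv_nonsing_inv A hA] at h
  have h0 : (fun i => (((0 : Fin d → ℤ) i : ℤ) : ℝ)) = 0 := by
    ext i
    simp
  simp only [h, h0, add_zero, Set.image_id']

lemma translation_eq_zero {d : ℕ} {P Q : Set (Fin d → ℝ)} (hP : IsCanonicalFano P)
    (hQ : 0 ∈ interior Q) {A : Matrix (Fin d) (Fin d) ℤ} (hA : IsUnit A.det) {b : Fin d → ℤ}
    (h : Q = (fun x => Matrix.toLin' (A.map (Int.castRingHom ℝ)) x + fun i => (b i : ℝ)) '' P) :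
    b = 0 := by
  set φ := fun x : Fin d → ℝ => Matrix.toLin' (A.map (Int.castRingHom ℝ)) x + fun i => (b i : ℝ)
    with hφ
  have hcont : Continuous φ :=
    (LinearMap.continuous_of_finiteDimensional _).add continuous_const
  have hA' : IsUnit (A⁻¹).det := A.isUnit_nonsing_inv_det hA
  have hinj : Function.Injective φ := by
    intro x y hxy
    have h1 := toLin'_nonsing_inv_apply hA'
    rw [Matrix.nonsing_inv_nonsing_inv A hA] at h1
    rw [← h1 x, ← h1 y, add_right_cancel hxy]
  set x := Matrix.toLin' (A⁻¹.map (Int.castRingHom ℝ)) (-fun i => (b i : ℝ)) with hx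
  have hφx : φ x = 0 := by
    simp only [hφ, hx, toLin'_nonsing_inv_apply hA, neg_add_cancel]
  have hxP : x ∈ interior P := by
    rw [← Set.preimage_image_eq P hinj, ← h]
    apply preimage_interior_subset_interior_preimage hcont
    rwa [Set.mem_preimage, hφx]
  have hxl : IsLatticePt x := fun i => ⟨(A⁻¹.mulVec (-b)) i, by
    rw [hx, Matrix.toLin'_apply]
    simp [Matrix.mulVec, dotProduct]⟩
  have hx0 : x = 0 := by
    have : x ∈ {x ∈ interior P | IsLatticePt x} := ⟨hxP, hxl⟩
    rwa [hP.2] at this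
  rw [hx0] at hφx
  ext i
  have := congrFun hφx i
  simpa [hφ] using this

lemma volume_polarDual_image {d : ℕ} {P : Set (Fin d → ℝ)} {A : Matrix (Fin d) (Fin d) ℤ}
    (hA : IsUnit A.det) :
    volume (polarDual (Matrix.toLin' (A.map (Int.castRingHom ℝ)) '' P)) =
      volume (polarDual P) := by
  have hpre : polarDual (Matrix.toLin' (A.map (Int.castRingHom ℝ)) '' P) =
      Matrix.toLin' (A.transpose.map (Int.castRingHom ℝ)) ⁻¹' polarDual P := by
    ext y
    have : ∀ x, ∑ i, y i * Matrix.toLin' (A.map (Int.castRingHom ℝ)) x i =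
        ∑ i, Matrix.toLin' (A.transpose.map (Int.castRingHom ℝ)) y i * x i := by
      intro x
      simp only [Matrix.toLin'_apply, Matrix.transpose_map, Matrix.mulVec_transpose]
      exact Matrix.dotProduct_mulVec _ _ _
    simp only [polarDual, Set.forall_mem_image, Set.preimage_ofPred_eq, Set.mem_ofPred_eq, this]
  have hdet :
      LinearMap.det (Matrix.toLin' (A.transpose.map (Int.castRingHom ℝ))) = (A.det : ℝ) := by
    rw [LinearMap.det_toLin', ← RingHom.mapMatrix_apply, ← RingHom.map_det, eq_intCast,
      Matrix.det_transpose]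
  have h1 : |(A.det : ℝ)| = 1 := by exact_mod_cast Int.isUnit_iff_abs_eq.mp hA
  rw [hpre, Measure.addHaar_preimage_linearMap _ (by rw [hdet]; exact_mod_cast hA.ne_zero), hdet,
    abs_inv, h1]
  simp

/-- For `d ≥ 4` and a canonical Fano polytope `P ⊂ ℝ^d`, the equality
`vol(P*) = 2(s_d - 1)^2 / d!` holds if and only if `P` is unimodularly equivalent to
`R_(d)*`, the dual of the simplex `R_(d)`. -/
theorem dual_volume_eq_iff (d : ℕ) (hd : 4 ≤ d) (P : Set (Fin d → ℝ))
    (hP : IsCanonicalFano P) :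
    volume (polarDual P) =
        ENNReal.ofReal (2 * ((sylvester (d - 1) : ℝ) - 1) ^ 2 / (d.factorial : ℝ)) ↔
      UnimodularEquiv P (polarDual (Rsimplex d)) := by
  have hs : (sylvester (d - 1) : ℝ) - 1 = sylvPred (d - 1) := by
    rw [sylvester_eq]
    push_cast
    ring
  rw [hs]
  constructor
  · intro hvol
    obtain ⟨V, hlat, rfl⟩ := hP.1
    obtain ⟨C, hCV, γ, hC, hCP, hcard⟩ := exists_circ_of_le_volume hd hlat hP hvol.ge
    obtain ⟨hle, hex⟩ := volume_polarDual_circ hd hC hCP hcard fun v hv => hlat v (hCV hv)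
    have h0 : 0 ∈ convexHull ℝ (C : Set (Fin d → ℝ)) :=
      Finset.mem_convexHull'.mpr ⟨γ, fun v hv => (hC.pos v hv).le, hC.sum, hC.zero⟩
    have hsub := subset_convexHull_of_volume_le hCV h0 (hle.trans hvol.ge)
      (hvol.trans_ne ENNReal.ofReal_ne_top)
    have hPC : convexHull ℝ (V : Set (Fin d → ℝ)) = convexHull ℝ (C : Set (Fin d → ℝ)) :=
      Subset.antisymm (convexHull_min hsub (convex_convexHull ℝ _))
        (convexHull_mono (by exact_mod_cast hCV))
    rw [hPC] at hvol ⊢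
    obtain ⟨N, hN, hCN⟩ := hex hvol.ge
    rw [hCN, ← LinearMap.image_convexHull, ← polarDual_Rsimplex (by omega)]
    exact unimodularEquiv_of_image hN
  · intro h
    obtain ⟨A, b, hA, hAb⟩ := unimodularEquiv_iff.mp h
    have hb := translation_eq_zero hP (zero_mem_interior_polarDual_Rsimplex d) hA hAb
    subst hb
    have hQ : polarDual (Rsimplex d) = Matrix.toLin' (A.map (Int.castRingHom ℝ)) '' P := by
      rw [hAb]
      refine Set.image_congr' fun x => ?_
      ext i
      simp
    rw [← volume_polarDual_image (P := P) hA, ← hQ, volume_polarDual_polarDual_Rsimplex (by omega)]
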